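/- Let I be a Cohen-Macaulay R-ideal of positive grade and let T be a flat local Gorenstein extension ring of R with IT ≠ T. Then ∫_T(IT) = (∫_R I)T. In particular, for every prime ideal p of R containing I, one has ∫_{R_p}(I_p) = (∫_R I)_p. -/

import Mathlib

open RingTheory IsLocalRing

/-- A proper ideal generated by a regular sequence is a complete intersection. -/
def IsCompleteIntersectionIdeal (R : Type) [CommRing R] (I : Ideal R) : Prop :=
  I ≠ ⊤ ∧ ∃ rs : List R, RingTheory.Sequence.IsRegular R rs ∧ Ideal.ofList rs = I

/-- Two proper ideals are directly linked if there is a complete intersection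
`c ⊆ I ⊓ J` with `I = c : J` and `J = c : I`. -/
def IsDirectlyLinked (R : Type) [CommRing R] (I J : Ideal R) : Prop :=
  I ≠ ⊤ ∧ J ≠ ⊤ ∧ ∃ c : Ideal R, IsCompleteIntersectionIdeal R c ∧ c ≤ I ⊓ J ∧
    Submodule.colon c J = I ∧ Submodule.colon c I = J

/-- The linkage (liaison) equivalence: the equivalence relation generated by direct linkage. -/
def InSameLinkageClass (R : Type) [CommRing R] (I J : Ideal R) : Prop :=
  Relation.EqvGen (IsDirectlyLinked R) I J

/-- An ideal is licci if its linkage class contains a complete intersection. -/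
def Licci (R : Type) [CommRing R] (I : Ideal R) : Prop :=
  ∃ J, InSameLinkageClass R I J ∧ IsCompleteIntersectionIdeal R J

open Classical in
/-- `∫ I` : the sum of all ideals in the linkage class of `I` if `I` is not licci,
and the unit ideal otherwise. -/
noncomputable def intLink (R : Type) [CommRing R] (I : Ideal R) : Ideal R :=
  if Licci R I then ⊤ else sSup {J : Ideal R | InSameLinkageClass R I J}

/-- An ideal is maximal in its linkage class if it contains every ideal in its linkage class. -/
def MaximalInLinkageClass (R : Type) [CommRing R] (I : Ideal R) : Prop :=
  ∀ J, InSameLinkageClass R I J → J ≤ I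

/-- Linked in `n` steps. -/
def LinkedInSteps (R : Type) [CommRing R] : ℕ → Ideal R → Ideal R → Prop
  | 0, I, J => I = J
  | (n+1), I, J => ∃ K, IsDirectlyLinked R I K ∧ LinkedInSteps R n K J

/-- The grade of an ideal: the supremum of lengths of regular sequences contained in it. -/
noncomputable def gradeOf (R : Type) [CommRing R] (I : Ideal R) : ℕ :=
  sSup {n : ℕ | ∃ rs : List R, rs.length = n ∧ (∀ r ∈ rs, r ∈ I) ∧
    RingTheory.Sequence.IsRegular R rs}

/-- A Noetherian local ring is Cohen-Macaulay if its depth (the grade of its maximal ideal)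
equals its Krull dimension. -/
def IsCMLocalRing (A : Type) [CommRing A] [IsLocalRing A] : Prop :=
  ringKrullDim A = (gradeOf A (maximalIdeal A) : WithBot (WithTop ℕ))

/-- An ideal `I` of `R` is a Cohen-Macaulay ideal if `R/I` is a Cohen-Macaulay local ring. -/
def IsCMIdeal (R : Type) [CommRing R] (I : Ideal R) : Prop :=
  ∃ h : IsLocalRing (R ⧸ I), @IsCMLocalRing (R ⧸ I) _ h

/-- A Noetherian local ring is Gorenstein if it is Cohen-Macaulay and some ideal generated
by a regular sequence and primary to the maximal ideal is irreducible. -/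
def IsGorensteinLocalRing (A : Type) [CommRing A] [IsLocalRing A] : Prop :=
  IsCMLocalRing A ∧ ∃ rs : List A, RingTheory.Sequence.IsRegular A rs ∧
    (Ideal.ofList rs).radical = maximalIdeal A ∧ InfIrred (Ideal.ofList rs)

section
open CategoryTheory Abelian TensorProduct

/-- The groups `Ext i M Q` over `A` vanish for `1 ≤ i ≤ n`. -/
def ExtVanish (n : ℕ) (A M Q : Type) [CommRing A] [AddCommGroup M] [Module A M]
    [AddCommGroup Q] [Module A Q] : Prop :=
  ∀ i, 0 < i → i ≤ n → Subsingleton (Ext (ModuleCat.of A M) (ModuleCat.of A Q) i)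

section
variable {A M N P Q : Type} [CommRing A] [AddCommGroup Q] [Module A Q] [AddCommGroup M] [Module A M] [AddCommGroup N] [Module A N]
  [AddCommGroup P] [Module A P]

lemma extVanish_zero : ExtVanish 0 A M Q := fun i hi hin => by omega

lemma ExtVanish.of_projective [Module.Projective A M] (n : ℕ) : ExtVanish n A M Q := by
  intro i hi _
  obtain ⟨j, rfl⟩ : ∃ j, i = j + 1 := ⟨i - 1, by omega⟩
  have : Projective (ModuleCat.of A M) := (ModuleCat.of A M).projective_of_categoryTheory_projective
  exact Ext.subsingleton_of_projective _ _ _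

lemma extVanish_succ_iff (i : N →ₗ[A] P) (p : P →ₗ[A] M) (hi : Function.Injective i)
    (hip : Function.Exact i p) (hp : Function.Surjective p) (hP : ∀ n, ExtVanish n A P Q) (n : ℕ) :
    ExtVanish (n + 1) A M Q ↔ (∀ φ : N →ₗ[A] Q, ∃ ψ : P →ₗ[A] Q, ψ ∘ₗ i = φ) ∧
      ExtVanish n A N Q := by
  let S : ShortComplex (ModuleCat.{0} A) := ShortComplex.mk (ModuleCat.ofHom i) (ModuleCat.ofHom p)
    (by ext x; exact hip.apply_apply_eq_zero x)
  have hS : S.ShortExact := by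
    refine { exact := ?_, mono_f := ?_, epi_g := ?_ }
    · exact (ShortComplex.ShortExact.moduleCat_exact_iff_function_exact S).2 hip
    · exact (ModuleCat.mono_iff_injective _).2 hi
    · exact (ModuleCat.epi_iff_surjective _).2 hp
  let Y := ModuleCat.of A Q
  constructor
  · intro h
    constructor
    · intro φ
      have h1 := h 1 one_pos (by omega)
      obtain ⟨x₂, hx₂⟩ := Ext.contravariant_sequence_exact₁ hS Y
        (Ext.mk₀ (ModuleCat.ofHom φ : ModuleCat.of A N ⟶ Y)) (add_zero 1) (h1.elim _ _)
      obtain ⟨ψ, rfl⟩ := (Ext.mk₀_bijective (X := S.X₂) (Y := Y)).2 x₂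
      rw [Ext.mk₀_comp_mk₀] at hx₂
      have := congr_arg ModuleCat.Hom.hom ((Ext.mk₀_bijective _ _).1 hx₂)
      exact ⟨ψ.hom, this⟩
    · intro j hj hjn
      refine subsingleton_of_forall_eq 0 fun (x : Ext S.X₁ Y j) => ?_
      obtain ⟨x₂, rfl⟩ := Ext.contravariant_sequence_exact₁ hS Y x (add_comm 1 j)
        ((h (j + 1) (by omega) (by omega)).elim _ _)
      rw [(hP j j hj le_rfl).elim x₂ 0, Ext.comp_zero]
  · rintro ⟨h1, h2⟩ j hj hjn
    refine subsingleton_of_forall_eq 0 fun (x : Ext S.X₃ Y j) => ?_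
    obtain ⟨k, rfl⟩ : ∃ k, j = 1 + k := ⟨j - 1, by omega⟩
    obtain ⟨x₁, rfl⟩ := Ext.contravariant_sequence_exact₃ hS Y x
      ((hP (1 + k) (1 + k) hj le_rfl).elim _ _) rfl
    rcases Nat.eq_zero_or_pos k with rfl | hk
    · obtain ⟨φ, rfl⟩ := (Ext.mk₀_bijective (X := S.X₁) (Y := Y)).2 x₁
      obtain ⟨ψ, hψ⟩ := h1 φ.hom
      have : φ = S.f ≫ ModuleCat.ofHom ψ := by ext1; exact hψ.symm
      rw [this, ← Ext.mk₀_comp_mk₀, hS.extClass_comp_assoc]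
    · rw [(h2 k hk (by omega)).elim x₁ 0, Ext.comp_zero]

lemma ExtVanish.congr {n : ℕ} (h : ExtVanish n A M Q) (e : M ≃ₗ[A] N) : ExtVanish n A N Q := by
  intro i hi hin
  have := h i hi hin
  let e' : ModuleCat.of A M ≅ ModuleCat.of A N := e.toModuleIso
  refine subsingleton_of_forall_eq 0 fun x => ?_
  have h0 : (Ext.mk₀ e'.hom).comp x (zero_add i) = 0 := this.elim _ _
  calc x = (Ext.mk₀ e'.inv).comp ((Ext.mk₀ e'.hom).comp x (zero_add i)) (zero_add i) := by
        rw [Ext.mk₀_comp_mk₀_assoc]; simp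
    _ = 0 := by rw [h0, Ext.comp_zero]
end

section

lemma extVanish_succ_iff_ker {A M P : Type} [CommRing A] [AddCommGroup M] [Module A M]
    [AddCommGroup P] [Module A P] {Q : Type} [AddCommGroup Q] [Module A Q] (p : P →ₗ[A] M) (hp : Function.Surjective p)
    (hP : ∀ n, ExtVanish n A P Q) (n : ℕ) :
    ExtVanish (n + 1) A M Q ↔
      (∀ φ : LinearMap.ker p →ₗ[A] Q, ∃ ψ : P →ₗ[A] Q, ψ ∘ₗ (LinearMap.ker p).subtype = φ) ∧
      ExtVanish n A (LinearMap.ker p) Q :=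
  extVanish_succ_iff _ p (Submodule.injective_subtype _) (LinearMap.exact_subtype_ker_map p) hp hP n

lemma ExtVanish.baseChange_of_flat {A : Type} [CommRing A] [IsNoetherianRing A] (A' : Type)
    [CommRing A'] [Algebra A A'] [Module.Flat A A'] (n : ℕ) :
    ∀ (M : Type) [AddCommGroup M] [Module A M] [Module.Finite A M],
      ExtVanish n A M A → ExtVanish n A' (A' ⊗[A] M) A' := by
  induction n with
  | zero => intros; exact extVanish_zero
  | succ n ih =>
    intro M _ _ _ h
    obtain ⟨k, f, hf⟩ := Module.Finite.exists_fin' A M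
    rw [extVanish_succ_iff_ker f hf (ExtVanish.of_projective)] at h
    refine (extVanish_succ_iff ((LinearMap.ker f).subtype.baseChange A') (f.baseChange A')
      ?_ ?_ ?_ (ExtVanish.of_projective) n).2 ⟨?_, ih _ h.2⟩
    · exact Module.Flat.lTensor_preserves_injective_linearMap _ (Submodule.injective_subtype _)
    · exact lTensor_exact A' (LinearMap.exact_subtype_ker_map f) hf
    · exact LinearMap.lTensor_surjective A' hf
    · have hfp := Module.finitePresentation_of_finite A (LinearMap.ker f)
      have hb := Module.FinitePresentation.isBaseChange_map A (LinearMap.ker f) A A'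
      suffices H : ∀ φ : A' ⊗[A] LinearMap.ker f →ₗ[A'] A' ⊗[A] A, ∃ ψ : A' ⊗[A] (Fin k → A) →ₗ[A'] A' ⊗[A] A,
          ψ ∘ₗ (LinearMap.ker f).subtype.baseChange A' = φ by
        intro φ
        obtain ⟨ψ, hψ⟩ := H ((AlgebraTensorModule.rid A A' A').symm.toLinearMap ∘ₗ φ)
        refine ⟨(AlgebraTensorModule.rid A A' A').toLinearMap ∘ₗ ψ, ?_⟩
        rw [LinearMap.comp_assoc, hψ, ← LinearMap.comp_assoc]
        ext; simp
      intro φ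
      induction φ using hb.inductionOn with
      | zero => exact ⟨0, by simp⟩
      | tmul g =>
        obtain ⟨ψ, rfl⟩ := h.1 g
        exact ⟨ψ.baseChange A', by rw [← LinearMap.baseChange_comp]; rfl⟩
      | smul s n hn =>
        obtain ⟨ψ, rfl⟩ := hn
        exact ⟨s • ψ, by rw [LinearMap.smul_comp]⟩
      | add n₁ n₂ h₁ h₂ =>
        obtain ⟨ψ₁, rfl⟩ := h₁
        obtain ⟨ψ₂, rfl⟩ := h₂
        exact ⟨ψ₁ + ψ₂, by rw [LinearMap.add_comp]⟩
end

section
variable {A D : Type} [CommRing A] [CommRing D] [Algebra A D]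

lemma ExtVanish.quotient_coeff {M : Type} [AddCommGroup M] [Module A M] {x : A}
    (hx : ∀ a, x * a = 0 → a = 0)
    (hs : Function.Surjective (algebraMap A D)) (hk : ∀ a, algebraMap A D a = 0 ↔ x ∣ a) (n : ℕ)
    (h : ExtVanish (n + 1) A M A) : ExtVanish n A M D := by
  let i : A →ₗ[A] A := LinearMap.mulLeft A x
  let p : A →ₗ[A] D := Algebra.linearMap A D
  have hip : Function.Exact i p := by
    intro a
    simp only [p, i, Algebra.linearMap_apply, hk, Set.mem_range, LinearMap.mulLeft_apply]
    exact ⟨fun ⟨b, hb⟩ => ⟨b, hb.symm⟩, fun ⟨b, hb⟩ => ⟨b, hb.symm⟩⟩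
  have hi : Function.Injective i := by
    rw [injective_iff_map_eq_zero]
    exact fun a ha => hx a ha
  let S : ShortComplex (ModuleCat.{0} A) := ShortComplex.mk (ModuleCat.ofHom i) (ModuleCat.ofHom p)
    (by ext; exact hip.apply_apply_eq_zero (1 : A))
  have hS : S.ShortExact := by
    refine { exact := ?_, mono_f := ?_, epi_g := ?_ }
    · exact (ShortComplex.ShortExact.moduleCat_exact_iff_function_exact S).2 hip
    · exact (ModuleCat.mono_iff_injective _).2 hi
    · exact (ModuleCat.epi_iff_surjective _).2 hs
  intro j hj hjn
  refine subsingleton_of_forall_eq 0 fun (y : Ext (ModuleCat.of A M) S.X₃ j) => ?_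
  obtain ⟨x₂, rfl⟩ := Ext.covariant_sequence_exact₃ (ModuleCat.of A M) hS y rfl
    ((h (j + 1) (by omega) (by omega)).elim _ _)
  rw [(h j hj (by omega)).elim x₂ 0, Ext.zero_comp]

variable (hs : Function.Surjective (algebraMap A D))
include hs

/-- A linear map to a `D`-module descends along a surjection to a `D`-module. -/
lemma exists_descend {M M' Q : Type} [AddCommGroup M] [Module A M] [AddCommGroup M'] [Module A M']
    [Module D M'] [IsScalarTower A D M'] [AddCommGroup Q] [Module A Q] [Module D Q]
    [IsScalarTower A D Q] (π : M →ₗ[A] M') (hπ : Function.Surjective π) (h : M →ₗ[A] Q)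
    (hk : ∀ m, π m = 0 → h m = 0) : ∃ h' : M' →ₗ[D] Q, ∀ m, h' (π m) = h m := by
  have hk' : LinearMap.ker π ≤ LinearMap.ker h := fun m hm => hk m hm
  let e := (π.quotKerEquivOfSurjective hπ)
  let g : M' →ₗ[A] Q := (LinearMap.ker π).liftQ h hk' ∘ₗ e.symm.toLinearMap
  refine ⟨LinearMap.extendScalarsOfSurjective hs g, fun m => ?_⟩
  change (LinearMap.ker π).liftQ h hk' (e.symm (π m)) = h m
  have : e.symm (π m) = Submodule.Quotient.mk m := by
    rw [LinearEquiv.symm_apply_eq]; rfl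
  rw [this]; rfl

/-- Change of coefficients along reduction modulo a regular element. -/
lemma extVanish_reduction_iff [IsNoetherianRing A] {x : A}
    (hx : ∀ a, x * a = 0 → a = 0) (hk : ∀ a, algebraMap A D a = 0 ↔ x ∣ a) (n : ℕ) :
    ∀ {M M' : Type} [AddCommGroup M] [Module A M] [Module.Finite A M] [AddCommGroup M'] [Module A M']
      [Module D M'] [IsScalarTower A D M'] (π : M →ₗ[A] M') (_ : Function.Surjective π)
      (_ : ∀ m, π m = 0 ↔ ∃ m', m = x • m') (_ : ∀ m : M, x • m = 0 → m = 0),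
      ExtVanish n A M D ↔ ExtVanish n D M' D := by
  induction n with
  | zero => intros; exact ⟨fun _ => extVanish_zero, fun _ => extVanish_zero⟩
  | succ n ih =>
    intro M M' _ _ _ _ _ _ _ π hπ hπk hreg
    have hx0 : algebraMap A D x = 0 := (hk x).2 dvd_rfl
    obtain ⟨k, f, hf⟩ := Module.Finite.exists_fin' A M
    let ι : (Fin k → A) →ₗ[A] (Fin k → D) := (Algebra.linearMap A D).compLeft (Fin k)
    have hι : Function.Surjective ι := fun v => by
      choose w hw using fun i => hs (v i)
      exact ⟨w, funext hw⟩
    have hιk : ∀ v, ι v = 0 ↔ ∃ w, v = x • w := by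
      intro v
      constructor
      · intro h
        choose w hw using fun i => (hk (v i)).1 (congr_fun h i)
        exact ⟨w, funext hw⟩
      · rintro ⟨w, rfl⟩
        rw [map_smul]
        ext i
        change x • ((ι w) i) = 0
        rw [Algebra.smul_def, hx0, zero_mul]
    obtain ⟨g, hg⟩ := exists_descend hs ι hι (π ∘ₗ f) (by
      intro m hm
      obtain ⟨w, rfl⟩ := (hιk m).1 hm
      exact (hπk _).2 ⟨f w, by simp⟩)
    have hgs : Function.Surjective g := fun m' => by
      obtain ⟨m, rfl⟩ := hπ m'
      obtain ⟨v, rfl⟩ := hf m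
      exact ⟨ι v, hg v⟩
    let ρ : LinearMap.ker f →ₗ[A] LinearMap.ker g :=
      { toFun := fun v => ⟨ι v, by
          have := hg v.1
          rw [LinearMap.mem_ker, this, LinearMap.comp_apply, LinearMap.mem_ker.1 v.2, map_zero]⟩
        map_add' := fun v w => by ext1; simp
        map_smul' := fun a v => by ext1; simp }
    have hρ : ∀ v, ((ρ v : LinearMap.ker g) : Fin k → D) = ι v := fun v => rfl
    have hρs : Function.Surjective ρ := by
      rintro ⟨v', hv'⟩
      obtain ⟨v, rfl⟩ := hι v'
      rw [LinearMap.mem_ker, hg] at hv'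
      obtain ⟨m, hm⟩ := (hπk _).1 hv'
      obtain ⟨u, rfl⟩ := hf m
      refine ⟨⟨v - x • u, by rw [LinearMap.mem_ker, map_sub, hm, map_smul, sub_self]⟩, ?_⟩
      ext1
      rw [hρ]
      change ι (v - x • u) = ι v
      rw [map_sub, (hιk (x • u)).2 ⟨u, rfl⟩, sub_zero]
    have hρk : ∀ v, ρ v = 0 ↔ ∃ w, v = x • w := by
      intro v
      rw [← Subtype.coe_inj, hρ, Submodule.coe_zero, hιk]
      constructor
      · rintro ⟨w, hw⟩
        refine ⟨⟨w, ?_⟩, Subtype.ext hw⟩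
        apply hreg
        rw [← map_smul, ← hw]
        exact v.2
      · rintro ⟨w, rfl⟩
        exact ⟨w, rfl⟩
    rw [extVanish_succ_iff_ker f hf (ExtVanish.of_projective),
      extVanish_succ_iff_ker g hgs (ExtVanish.of_projective)]
    refine and_congr ⟨fun H φ' => ?_, fun H φ => ?_⟩ (ih ρ hρs hρk fun v hv => ?_)
    · obtain ⟨ψ, hψ⟩ := H (φ'.restrictScalars A ∘ₗ ρ)
      obtain ⟨ψ', hψ'⟩ := exists_descend hs ι hι ψ (by
        intro m hm
        obtain ⟨w, rfl⟩ := (hιk m).1 hm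
        rw [map_smul, Algebra.smul_def, hx0, zero_mul])
      refine ⟨ψ', LinearMap.ext fun v' => ?_⟩
      obtain ⟨v, rfl⟩ := hρs v'
      exact (hψ' _).trans (LinearMap.congr_fun hψ v)
    · obtain ⟨φ', hφ'⟩ := exists_descend hs ρ hρs φ (by
        intro m hm
        obtain ⟨w, rfl⟩ := (hρk m).1 hm
        rw [map_smul, Algebra.smul_def, hx0, zero_mul])
      obtain ⟨ψ', hψ'⟩ := H φ'
      refine ⟨ψ'.restrictScalars A ∘ₗ ι, LinearMap.ext fun v => ?_⟩
      exact (LinearMap.congr_fun hψ' (ρ v)).trans (hφ' v)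
    · ext i
      exact hx _ (congr_fun (congr_arg Subtype.val hv) i)

/-- Nakayama: vanishing modulo `x` implies vanishing. -/
lemma ExtVanish.of_quotient_coeff [IsNoetherianRing A] [IsLocalRing A] {x : A}
    (hxm : x ∈ IsLocalRing.maximalIdeal A) (hx : ∀ a, x * a = 0 → a = 0)
    (hk : ∀ a, algebraMap A D a = 0 ↔ x ∣ a) (n : ℕ) :
    ∀ {M : Type} [AddCommGroup M] [Module A M] [Module.Finite A M],
      ExtVanish n A M D → ExtVanish n A M A := by
  induction n with
  | zero => intros; exact extVanish_zero
  | succ n ih =>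
    intro M _ _ _ h
    obtain ⟨k, f, hf⟩ := Module.Finite.exists_fin' A M
    rw [extVanish_succ_iff_ker f hf (ExtVanish.of_projective)] at h ⊢
    refine ⟨?_, ih h.2⟩
    let res : ((Fin k → A) →ₗ[A] A) →ₗ[A] (LinearMap.ker f →ₗ[A] A) :=
      LinearMap.lcomp A A (LinearMap.ker f).subtype
    suffices H : LinearMap.range res = ⊤ by
      intro φ
      exact LinearMap.range_eq_top.1 H φ
    refine eq_top_iff.2 (Submodule.le_of_le_smul_of_le_jacobson_bot (I := Ideal.span {x})
      Module.Finite.fg_top ?_ ?_)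
    · rw [IsLocalRing.jacobson_eq_maximalIdeal _ bot_ne_top]
      simpa using hxm
    · intro φ _
      obtain ⟨ψ, hψ⟩ := h.1 ((Algebra.linearMap A D) ∘ₗ φ)
      obtain ⟨χ, hχ⟩ := Module.projective_lifting_property (Algebra.linearMap A D) ψ hs
      have hd : ∀ v, ∃ b, φ v - res χ v = x * b := by
        intro v
        apply (hk _).1
        rw [map_sub, sub_eq_zero]
        exact (LinearMap.congr_fun hψ v).symm.trans (LinearMap.congr_fun hχ (v : Fin k → A)).symm
      choose d hd using hd
      have hinj : ∀ a b, x * a = x * b → a = b := fun a b hab => by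
        rw [← sub_eq_zero]; exact hx _ (by rw [mul_sub, hab, sub_self])
      let δ : LinearMap.ker f →ₗ[A] A :=
        { toFun := d
          map_add' := fun v w => hinj _ _ (by
            rw [mul_add, ← hd, ← hd, ← hd, map_add, map_add]; ring)
          map_smul' := fun a v => hinj _ _ (by
            rw [RingHom.id_apply, smul_eq_mul, mul_left_comm, ← hd, ← hd, map_smul, map_smul,
              smul_eq_mul, smul_eq_mul]; ring) }
      have : φ = res χ + x • δ := by
        ext v
        change φ v = res χ v + x * d v
        rw [← hd]; ring
      rw [this]
      exact Submodule.add_mem_sup ⟨χ, rfl⟩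
        (Submodule.smul_mem_smul (Ideal.mem_span_singleton_self x) trivial)

omit hs in
lemma ExtVanish.pi {Q M : Type} [AddCommGroup M] [Module A M] [AddCommGroup Q] [Module A Q] {n : ℕ}
    (h : ExtVanish n A M Q) (k : ℕ) : ExtVanish n A (Fin k → M) Q := by
  induction k with
  | zero => exact ExtVanish.of_projective n
  | succ k ih =>
    let i : M →ₗ[A] (Fin (k + 1) → M) := LinearMap.single A (fun _ => M) 0
    let p : (Fin (k + 1) → M) →ₗ[A] (Fin k → M) := LinearMap.funLeft A M Fin.succ
    have hip : Function.Exact i p := by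
      intro v
      constructor
      · intro hv
        refine ⟨v 0, funext fun j => ?_⟩
        refine Fin.cases ?_ (fun j => ?_) j
        · simp [i]
        · have := (congr_fun hv j).symm
          simp only [Pi.zero_apply, p, LinearMap.funLeft_apply] at this
          simpa [i] using this
      · rintro ⟨m, rfl⟩
        ext j
        simp [i, p, LinearMap.funLeft]
    let S : ShortComplex (ModuleCat.{0} A) := ShortComplex.mk (ModuleCat.ofHom i)
      (ModuleCat.ofHom p) (by ext1; exact hip.linearMap_comp_eq_zero)
    have hS : S.ShortExact := by
      refine { exact := ?_, mono_f := ?_, epi_g := ?_ }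
      · exact (ShortComplex.ShortExact.moduleCat_exact_iff_function_exact S).2 hip
      · exact (ModuleCat.mono_iff_injective _).2 (Pi.single_injective (M := fun _ => M) 0)
      · exact (ModuleCat.epi_iff_surjective _).2
          (LinearMap.funLeft_surjective_of_injective _ _ _ (Fin.succ_injective k))
    intro j hj hjn
    refine subsingleton_of_forall_eq 0 fun (x : Ext S.X₂ (ModuleCat.of A Q) j) => ?_
    obtain ⟨y, rfl⟩ := Ext.contravariant_sequence_exact₂ hS _ x ((h j hj hjn).elim _ _)
    rw [(ih j hj hjn).elim y 0, Ext.comp_zero]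

/-- Change of rings along a quotient whose dual is cyclic. -/
lemma extVanish_changeRings_iff [IsNoetherianRing D] {a : A}
    (hk : ∀ b, algebraMap A D b = 0 ↔ a * b = 0)
    (hD : ∀ c, (∀ b, a * b = 0 → b * c = 0) → a ∣ c)
    (hv : ∀ n, ExtVanish n A D A) (n : ℕ) :
    ∀ {M : Type} [AddCommGroup M] [Module A M] [Module D M] [IsScalarTower A D M]
      [Module.Finite D M], ExtVanish n A M A ↔ ExtVanish n D M D := by
  induction n with
  | zero => intros; exact ⟨fun _ => extVanish_zero, fun _ => extVanish_zero⟩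
  | succ n ih =>
    intro M _ _ _ _ _
    obtain ⟨k, g, hg⟩ := Module.Finite.exists_fin' D M
    obtain ⟨θ, hθ⟩ := exists_descend (M := A) (M' := D) (Q := A) (A := A) (D := A)
      Function.surjective_id (Algebra.linearMap A D) hs (LinearMap.mulLeft A a) (fun b hb => (hk b).1 hb)
    have hθi : Function.Injective θ := by
      rw [injective_iff_map_eq_zero]
      intro d hd
      obtain ⟨b, rfl⟩ := hs d
      exact (hk b).2 ((hθ b).symm.trans hd)
    rw [extVanish_succ_iff ((LinearMap.ker g).subtype.restrictScalars A) (g.restrictScalars A)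
      (Submodule.injective_subtype _) (LinearMap.exact_subtype_ker_map g) hg
      (fun n => (hv n).pi k), extVanish_succ_iff_ker g hg (ExtVanish.of_projective)]
    refine and_congr ⟨fun H φ' => ?_, fun H φ => ?_⟩ ih
    · obtain ⟨ψ, hψ⟩ := H (θ ∘ₗ φ'.restrictScalars A)
      have him : ∀ v, ∃ d, θ d = ψ v := fun v => by
        obtain ⟨e, he⟩ := hD (ψ v) (fun b hb => by
          rw [← smul_eq_mul, ← map_smul, ← algebraMap_smul D b v, (hk b).2 hb, zero_smul, map_zero])
        exact ⟨algebraMap A D e, (hθ e).trans he.symm⟩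
      choose d hd using him
      let ψ' : (Fin k → D) →ₗ[A] D :=
        { toFun := d
          map_add' := fun v w => hθi (by rw [map_add, hd, hd, hd, map_add])
          map_smul' := fun c v => hθi (by rw [hd, RingHom.id_apply, map_smul, map_smul, hd]) }
      refine ⟨LinearMap.extendScalarsOfSurjective hs ψ', LinearMap.ext fun v => hθi ?_⟩
      exact (hd _).trans (LinearMap.congr_fun hψ v)
    · have him : ∀ v, ∃ d, θ d = φ v := fun v => by
        obtain ⟨e, he⟩ := hD (φ v) (fun b hb => by
          rw [← smul_eq_mul, ← map_smul, ← algebraMap_smul D b v, (hk b).2 hb, zero_smul, map_zero])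
        exact ⟨algebraMap A D e, (hθ e).trans he.symm⟩
      choose d hd using him
      let φ' : LinearMap.ker g →ₗ[A] D :=
        { toFun := d
          map_add' := fun v w => hθi (by rw [map_add, hd, hd, hd, map_add])
          map_smul' := fun c v => hθi (by rw [hd, RingHom.id_apply, map_smul, map_smul, hd]) }
      obtain ⟨ψ', hψ'⟩ := H (LinearMap.extendScalarsOfSurjective hs φ')
      refine ⟨θ ∘ₗ ψ'.restrictScalars A, LinearMap.ext fun v => ?_⟩
      exact (congr_arg θ (LinearMap.congr_fun hψ' v)).trans (hd v)
end

lemma mem_colon_ideal {A : Type} [CommRing A] {c K : Ideal A} {r : A} :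
    r ∈ c.colon (K : Set A) ↔ ∀ s ∈ K, r * s ∈ c := Submodule.mem_colon

lemma mem_colon_span_range {A ι : Type} [CommRing A] {c : Ideal A} {k : ι → A} {r : A} :
    r ∈ c.colon (Ideal.span (Set.range k) : Set A) ↔ ∀ i, r * k i ∈ c := by
  rw [Ideal.span, Submodule.colon_span, Submodule.mem_colon]
  simp

lemma map_colon_le {A A' : Type} [CommRing A] [CommRing A'] (f : A →+* A') (c K : Ideal A) :
    (c.colon (K : Set A)).map f ≤ (c.map f).colon (K.map f : Set A') := by
  rw [Ideal.map_le_iff_le_comap]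
  intro a ha
  rw [Ideal.mem_comap, Ideal.map.eq_1 f K, Ideal.span, Submodule.colon_span, Submodule.mem_colon]
  rintro _ ⟨k, hk, rfl⟩
  rw [smul_eq_mul, ← map_mul]
  exact Ideal.mem_map_of_mem f (mem_colon_ideal.1 ha k hk)

lemma map_colon_of_flat {A A' : Type} [CommRing A] [CommRing A'] [Algebra A A'] [Module.Flat A A']
    (c K : Ideal A) (hK : K.FG) :
    (c.colon (K : Set A)).map (algebraMap A A') =
      (c.map (algebraMap A A')).colon (K.map (algebraMap A A') : Set A') := by
  refine le_antisymm (map_colon_le _ _ _) fun t ht => ?_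
  obtain ⟨r, k, rfl⟩ := Submodule.fg_iff_exists_fin_generating_family.1 hK
  let I := c.colon (Submodule.span A (Set.range k) : Set A)
  let m : A →ₗ[A] (Fin r → A ⧸ c) := LinearMap.pi fun i => c.mkQ ∘ₗ LinearMap.mulRight A (k i)
  have hex : Function.Exact I.subtype m := by
    intro a
    have : m a = 0 ↔ a ∈ I := by
      rw [mem_colon_span_range, funext_iff]
      exact forall_congr' fun i => Submodule.Quotient.mk_eq_zero c
    rw [this]; simp
  have hex' := Module.Flat.lTensor_exact A' hex
  have h0 : (m.lTensor A') (t ⊗ₜ 1) = 0 := by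
    apply (TensorProduct.piRight A A A' (fun _ : Fin r => A ⧸ c)).injective
    rw [map_zero]
    ext i
    rw [LinearMap.lTensor_tmul, TensorProduct.piRight_apply, TensorProduct.piRightHom_tmul]
    have h1 := mem_colon_ideal.1 ht (algebraMap A A' (k i))
      (Ideal.mem_map_of_mem _ (Submodule.subset_span ⟨i, rfl⟩))
    have h2 := (Algebra.TensorProduct.quotIdealMapEquivTensorQuot A' c).commutes
      (t * algebraMap A A' (k i))
    rw [Ideal.Quotient.algebraMap_eq, Ideal.Quotient.eq_zero_iff_mem.2 h1, map_zero,
      Algebra.TensorProduct.algebraMap_apply, Algebra.algebraMap_self, RingHom.id_apply,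
      mul_comm, ← Algebra.smul_def, TensorProduct.smul_tmul] at h2
    rw [Pi.zero_apply, h2]
    have h3 : Ideal.Quotient.mk c (1 * k i) = k i • (1 : A ⧸ c) := by
      rw [one_mul, Algebra.smul_def, mul_one]; rfl
    exact congr_arg (t ⊗ₜ[A] ·) h3
  obtain ⟨y, hy⟩ := (hex' _).1 h0
  have : ∀ y : A' ⊗[A] I, TensorProduct.rid A A' (I.subtype.lTensor A' y) ∈ I.map (algebraMap A A') := by
    intro y
    induction y with
    | zero => simp
    | add x y hx hy => rw [map_add, map_add]; exact add_mem hx hy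
    | tmul x y =>
      rw [LinearMap.lTensor_tmul, TensorProduct.rid_tmul, Algebra.smul_def]
      exact Ideal.mul_mem_right _ _ (Ideal.mem_map_of_mem _ y.2)
  have h2 := this y
  rw [hy, TensorProduct.rid_tmul, one_smul] at h2
  exact h2

/-- `K` is a reflexive ideal whose quotient and whose linked quotient are totally reflexive. -/
structure GRefl (A : Type) [CommRing A] (K : Ideal A) : Prop where
  ext : ∀ n, ExtVanish n A (A ⧸ K) A
  ext_perp : ∀ n, ExtVanish n A (A ⧸ (⊥ : Ideal A).colon (K : Set A)) A
  perp_perp : (⊥ : Ideal A).colon ((⊥ : Ideal A).colon (K : Set A) : Set A) = K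

lemma le_colon_colon {A : Type} [CommRing A] (c K : Ideal A) :
    K ≤ c.colon (c.colon (K : Set A) : Set A) := fun k hk =>
  mem_colon_ideal.2 fun s hs => by rw [mul_comm]; exact mem_colon_ideal.1 hs k hk

lemma GRefl.perp {A : Type} [CommRing A] {K : Ideal A} (h : GRefl A K) :
    GRefl A ((⊥ : Ideal A).colon (K : Set A)) where
  ext := h.ext_perp
  ext_perp := by rw [h.perp_perp]; exact h.ext
  perp_perp := by rw [h.perp_perp]

lemma ExtVanish.quotient_map_of_flat {A A' : Type} [CommRing A] [IsNoetherianRing A] [CommRing A']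
    [Algebra A A'] [Module.Flat A A'] {n : ℕ} {K : Ideal A} (h : ExtVanish n A (A ⧸ K) A) :
    ExtVanish n A' (A' ⧸ K.map (algebraMap A A')) A' :=
  (h.baseChange_of_flat A' n (A ⧸ K)).congr
    (Algebra.TensorProduct.quotIdealMapEquivTensorQuot A' K).symm.toLinearEquiv

lemma GRefl.map_of_flat {A A' : Type} [CommRing A] [IsNoetherianRing A] [CommRing A']
    [Algebra A A'] [Module.Flat A A'] {K : Ideal A} (h : GRefl A K) :
    GRefl A' (K.map (algebraMap A A')) := by
  have h1 : ∀ L : Ideal A, (⊥ : Ideal A').colon (L.map (algebraMap A A') : Set A') =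
      ((⊥ : Ideal A).colon (L : Set A)).map (algebraMap A A') := fun L => by
    rw [map_colon_of_flat _ _ (IsNoetherian.noetherian L), Ideal.map_bot]
  refine ⟨fun n => (h.ext n).quotient_map_of_flat, ?_, ?_⟩
  · rw [h1]
    exact fun n => (h.ext_perp n).quotient_map_of_flat
  · rw [h1, h1, h.perp_perp]

section
variable {A : Type} [CommRing A]

lemma ExtVanish.exists_mul_eq {K : Ideal A} (h : ExtVanish 1 A (A ⧸ K) A) (φ : K →ₗ[A] A) :
    ∃ e, ∀ k : K, φ k = e * k := by
  obtain ⟨ψ, hψ⟩ := ((extVanish_succ_iff K.subtype K.mkQ (Submodule.injective_subtype _)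
    (LinearMap.exact_subtype_mkQ K) K.mkQ_surjective (ExtVanish.of_projective) 0).1 h).1 φ
  refine ⟨ψ 1, fun k => ?_⟩
  rw [← hψ, mul_comm, ← smul_eq_mul, ← map_smul, smul_eq_mul, mul_one]; rfl

variable {D : Type} [CommRing D] [Algebra A D]
  (hs : Function.Surjective (algebraMap A D))

include hs

/-- The annihilator of `K` specialises modulo a regular element if `Ext¹` vanishes. -/
lemma colon_map_of_extVanish {x : A} (hx : ∀ a, x * a = 0 → a = 0)
    (hk : ∀ a, algebraMap A D a = 0 ↔ x ∣ a) {K : Ideal A} (h : ExtVanish 1 A (A ⧸ K) A) :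
    (⊥ : Ideal D).colon (K.map (algebraMap A D) : Set D) =
      ((⊥ : Ideal A).colon (K : Set A)).map (algebraMap A D) := by
  apply le_antisymm
  · intro d hd
    obtain ⟨a, rfl⟩ := hs d
    have : ∀ k : K, ∃ b, a * k = x * b := fun k => by
      apply (hk _).1
      rw [map_mul]
      exact mem_colon_ideal.1 hd _ (Ideal.mem_map_of_mem _ k.2)
    choose φ hφ using this
    have hinj : ∀ a b, x * a = x * b → a = b := fun a b hab => by
      rw [← sub_eq_zero]; exact hx _ (by rw [mul_sub, hab, sub_self])
    obtain ⟨e, he⟩ := h.exists_mul_eq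
      { toFun := φ
        map_add' := fun k l => hinj _ _ (by rw [mul_add, ← hφ, ← hφ, ← hφ, Submodule.coe_add, mul_add])
        map_smul' := fun r k => hinj _ _ (by
          rw [RingHom.id_apply, smul_eq_mul, mul_left_comm, ← hφ, ← hφ, Submodule.coe_smul,
            smul_eq_mul, mul_left_comm]) }
    have : algebraMap A D a = algebraMap A D (a - x * e) := by
      rw [map_sub, (hk (x * e)).2 ⟨e, rfl⟩, sub_zero]
    rw [this]
    refine Ideal.mem_map_of_mem _ (mem_colon_ideal.2 fun k hk' => ?_)
    have h1 : φ ⟨k, hk'⟩ = e * k := he ⟨k, hk'⟩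
    have h2 := hφ ⟨k, hk'⟩
    rw [h1] at h2
    rw [Ideal.mem_bot, sub_mul, h2]; ring
  · have := map_colon_le (algebraMap A D) ⊥ K
    rwa [Ideal.map_bot] at this

omit hs in
lemma regular_mod_colon {x : A} (hx : ∀ a, x * a = 0 → a = 0) (K : Ideal A) (a : A)
    (h : x * a ∈ (⊥ : Ideal A).colon (K : Set A)) : a ∈ (⊥ : Ideal A).colon (K : Set A) :=
  mem_colon_ideal.2 fun k hk => hx _ (by rw [← mul_assoc]; exact mem_colon_ideal.1 h k hk)

lemma extVanish_quotient_reduction_iff [IsNoetherianRing A] {x : A} (hx : ∀ a, x * a = 0 → a = 0)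
    (hk : ∀ a, algebraMap A D a = 0 ↔ x ∣ a) {K : Ideal A} (hxK : ∀ a, x * a ∈ K → a ∈ K) (n : ℕ) :
    ExtVanish n A (A ⧸ K) D ↔ ExtVanish n D (D ⧸ K.map (algebraMap A D)) D := by
  let π : (A ⧸ K) →ₗ[A] (D ⧸ K.map (algebraMap A D)) :=
    K.liftQ (((K.map (algebraMap A D)).mkQ.restrictScalars A) ∘ₗ Algebra.linearMap A D)
      (fun k hk => (Submodule.Quotient.mk_eq_zero _).2 (Ideal.mem_map_of_mem _ hk))
  have hπ : ∀ a, π (Submodule.Quotient.mk a) = Submodule.Quotient.mk (algebraMap A D a) :=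
    fun a => rfl
  refine extVanish_reduction_iff hs hx hk n π ?_ ?_ ?_
  · intro m
    obtain ⟨d, rfl⟩ := Submodule.Quotient.mk_surjective _ m
    obtain ⟨a, rfl⟩ := hs d
    exact ⟨Submodule.Quotient.mk a, hπ a⟩
  · intro m
    obtain ⟨a, rfl⟩ := Submodule.Quotient.mk_surjective _ m
    rw [hπ, Submodule.Quotient.mk_eq_zero, Ideal.mem_map_iff_of_surjective _ hs]
    constructor
    · rintro ⟨k, hkK, hka⟩
      obtain ⟨b, hb⟩ := (hk (a - k)).1 (by rw [map_sub, hka, sub_self])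
      refine ⟨Submodule.Quotient.mk b, ?_⟩
      rw [← Submodule.Quotient.mk_smul, Submodule.Quotient.eq, smul_eq_mul, ← hb]
      simpa using hkK
    · rintro ⟨m', hm'⟩
      obtain ⟨b, rfl⟩ := Submodule.Quotient.mk_surjective _ m'
      rw [← Submodule.Quotient.mk_smul, Submodule.Quotient.eq, smul_eq_mul] at hm'
      exact ⟨_, hm', by rw [map_sub, (hk (x * b)).2 ⟨b, rfl⟩, sub_zero]⟩
  · intro m hm
    obtain ⟨a, rfl⟩ := Submodule.Quotient.mk_surjective _ m
    rw [← Submodule.Quotient.mk_smul, Submodule.Quotient.mk_eq_zero] at hm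
    rw [Submodule.Quotient.mk_eq_zero]
    exact hxK a hm

lemma GRefl.specialize [IsNoetherianRing A] {x : A} (hx : ∀ a, x * a = 0 → a = 0)
    (hk : ∀ a, algebraMap A D a = 0 ↔ x ∣ a) {K : Ideal A} (h : GRefl A K) :
    GRefl D (K.map (algebraMap A D)) where
  ext n := (extVanish_quotient_reduction_iff hs hx hk
    (fun a ha => by rw [← h.perp_perp] at ha ⊢; exact regular_mod_colon hx _ a ha) n).1
    ((h.ext (n + 1)).quotient_coeff hx hs hk)
  ext_perp n := by
    rw [colon_map_of_extVanish hs hx hk (h.ext 1)]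
    exact (extVanish_quotient_reduction_iff hs hx hk (regular_mod_colon hx _) n).1
      ((h.ext_perp (n + 1)).quotient_coeff hx hs hk)
  perp_perp := by
    rw [colon_map_of_extVanish hs hx hk (h.ext 1), colon_map_of_extVanish hs hx hk (h.ext_perp 1),
      h.perp_perp]

lemma GRefl.deform [IsNoetherianRing A] [IsLocalRing A] {x : A}
    (hxm : x ∈ IsLocalRing.maximalIdeal A) (hx : ∀ a, x * a = 0 → a = 0)
    (hk : ∀ a, algebraMap A D a = 0 ↔ x ∣ a) {K : Ideal A} (hxK : ∀ a, x * a ∈ K → a ∈ K)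
    (h : GRefl D (K.map (algebraMap A D))) : GRefl A K := by
  have h1 : ∀ n, ExtVanish n A (A ⧸ K) A := fun n => ExtVanish.of_quotient_coeff hs hxm hx hk n
    ((extVanish_quotient_reduction_iff hs hx hk hxK n).2 (h.ext n))
  have e1 := colon_map_of_extVanish hs hx hk (h1 1)
  have h2 : ∀ n, ExtVanish n A (A ⧸ (⊥ : Ideal A).colon (K : Set A)) A := fun n =>
    ExtVanish.of_quotient_coeff hs hxm hx hk n
    ((extVanish_quotient_reduction_iff hs hx hk (regular_mod_colon hx _) n).2
      (by rw [← e1]; exact h.ext_perp n))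
  have e2 := colon_map_of_extVanish hs hx hk (h2 1)
  rw [← e1, h.perp_perp] at e2
  refine ⟨h1, h2, le_antisymm ?_ (le_colon_colon _ _)⟩
  refine Submodule.le_of_le_smul_of_le_jacobson_bot (I := Ideal.span {x})
      (IsNoetherian.noetherian _) ?_ ?_
  · rw [IsLocalRing.jacobson_eq_maximalIdeal _ bot_ne_top]
    simpa using hxm
  · intro u hu
    have := Ideal.mem_map_of_mem (algebraMap A D) hu
    rw [← e2, Ideal.mem_map_iff_of_surjective _ hs] at this
    obtain ⟨k, hkK, hku⟩ := this
    obtain ⟨b, hb⟩ := (hk (u - k)).1 (by rw [map_sub, hku, sub_self])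
    have hu' : u = k + x * b := by rw [← hb]; ring
    have hb' : x * b ∈ (⊥ : Ideal A).colon ((⊥ : Ideal A).colon (K : Set A) : Set A) := by
      rw [← hb]; exact sub_mem hu (le_colon_colon _ _ hkK)
    rw [hu']
    exact Submodule.add_mem_sup hkK (Submodule.smul_mem_smul (Ideal.mem_span_singleton_self x)
      (regular_mod_colon hx _ _ hb'))
end

section
variable {C : Type} [CommRing C]

/-- The periodic resolution attached to an exact pair of zero divisors. -/
lemma extVanish_quotient_of_exact_pair (n : ℕ) : ∀ {a b : C} (_ : ∀ c, a * c = 0 ↔ b ∣ c)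
    (_ : ∀ c, b * c = 0 ↔ a ∣ c), ExtVanish n C (C ⧸ Ideal.span {b}) C := by
  induction n with
  | zero => intros; exact extVanish_zero
  | succ n ih =>
    intro a b ha hb
    let i : (C ⧸ Ideal.span {a}) →ₗ[C] C := (Ideal.span {a}).liftQ (LinearMap.mulLeft C b) (by
      intro c hc
      exact (hb c).2 (Ideal.mem_span_singleton.1 hc))
    have hi : ∀ c, i (Submodule.Quotient.mk c) = b * c := fun c => rfl
    refine (extVanish_succ_iff i (Ideal.span {b}).mkQ ?_ ?_ (Submodule.mkQ_surjective _)
      (ExtVanish.of_projective) n).2 ⟨fun φ => ?_, ih hb ha⟩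
    · rw [injective_iff_map_eq_zero]
      intro m hm
      obtain ⟨c, rfl⟩ := Submodule.Quotient.mk_surjective _ m
      rw [hi, hb] at hm
      rwa [Submodule.Quotient.mk_eq_zero, Ideal.mem_span_singleton]
    · intro c
      rw [Submodule.mkQ_apply, Submodule.Quotient.mk_eq_zero, Ideal.mem_span_singleton]
      constructor
      · rintro ⟨d, rfl⟩
        exact ⟨Submodule.Quotient.mk d, hi d⟩
      · rintro ⟨m, rfl⟩
        obtain ⟨d, rfl⟩ := Submodule.Quotient.mk_surjective _ m
        exact ⟨d, hi d⟩
    · obtain ⟨e, he⟩ := (ha (φ (Submodule.Quotient.mk 1))).1 (by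
        rw [← smul_eq_mul, ← map_smul, ← Submodule.Quotient.mk_smul,
          (Submodule.Quotient.mk_eq_zero _).2 (by simp), map_zero])
      refine ⟨LinearMap.mulLeft C e, LinearMap.ext fun m => ?_⟩
      obtain ⟨d, rfl⟩ := Submodule.Quotient.mk_surjective _ m
      have : φ (Submodule.Quotient.mk d) = d * φ (Submodule.Quotient.mk 1) := by
        rw [← smul_eq_mul, ← map_smul, ← Submodule.Quotient.mk_smul, smul_eq_mul, mul_one]
      rw [this, he, LinearMap.comp_apply, hi, LinearMap.mulLeft_apply]
      ring

variable {D : Type} [CommRing D] [Algebra C D]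
  (hs : Function.Surjective (algebraMap C D))

include hs

lemma GRefl_iff_of_exact_pair [IsNoetherianRing D] {a b : C} (ha : ∀ c, a * c = 0 ↔ b ∣ c)
    (hb : ∀ c, b * c = 0 ↔ a ∣ c) (hk : ∀ c, algebraMap C D c = 0 ↔ b ∣ c)
    {K : Ideal C} (hbK : b ∈ K) :
    GRefl C K ↔ GRefl D (K.map (algebraMap C D)) := by
  have hk' : ∀ c, algebraMap C D c = 0 ↔ a * c = 0 := fun c => (hk c).trans (ha c).symm
  have hD : ∀ c, (∀ b, a * b = 0 → b * c = 0) → a ∣ c := fun c hc =>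
    (hb c).1 (hc b ((ha b).2 dvd_rfl))
  have hkerK : ∀ c, algebraMap C D c ∈ K.map (algebraMap C D) ↔ c ∈ K := fun c => by
    refine ⟨fun h => ?_, Ideal.mem_map_of_mem _⟩
    obtain ⟨k, hkK, hkc⟩ := (Ideal.mem_map_iff_of_surjective _ hs).1 h
    obtain ⟨d, hd⟩ := (hk (c - k)).1 (by rw [map_sub, hkc, sub_self])
    have : c = k + b * d := by rw [← hd]; ring
    rw [this]
    exact add_mem hkK (Ideal.mul_mem_right _ _ hbK)
  have hv : ∀ n, ExtVanish n C D C := fun n =>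
    (extVanish_quotient_of_exact_pair n ha hb).congr
      ((Submodule.quotEquivOfEq _ _ (by
        ext c; rw [Ideal.mem_span_singleton, LinearMap.mem_ker]; exact (hk c).symm)).trans
        ((Algebra.linearMap C D).quotKerEquivOfSurjective hs))
  obtain ⟨θ, hθ⟩ := exists_descend (M := C) (M' := D) (Q := C) (A := C) (D := C)
      Function.surjective_id (Algebra.linearMap C D) hs (LinearMap.mulLeft C a)
      (fun b hb => (hk' b).1 hb)
  replace hθ : ∀ c, θ (algebraMap C D c) = a * c := hθ
  have hθi : Function.Injective θ := by
    rw [injective_iff_map_eq_zero]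
    intro d hd
    obtain ⟨b, rfl⟩ := hs d
    exact (hk' b).2 ((hθ b).symm.trans hd)
  set KD := K.map (algebraMap C D) with hKD
  set PC := (⊥ : Ideal C).colon (K : Set C) with hPC
  set PD := (⊥ : Ideal D).colon (KD : Set D) with hPD
  have hPDmem : ∀ c, algebraMap C D c ∈ PD ↔ ∀ k ∈ K, a * c * k = 0 := by
    intro c
    rw [hPD, mem_colon_ideal]
    constructor
    · intro h k hkK
      rw [mul_assoc, ← hk', map_mul]
      exact h _ (Ideal.mem_map_of_mem _ hkK)
    · intro h d hd
      obtain ⟨k, hkK, rfl⟩ := (Ideal.mem_map_iff_of_surjective _ hs).1 hd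
      rw [← map_mul, Ideal.mem_bot, hk', ← mul_assoc]
      exact h k hkK
  have hPCmem : ∀ c, c ∈ PC ↔ ∃ u, algebraMap C D u ∈ PD ∧ c = a * u := by
    intro c
    constructor
    · intro hc
      have hc' := mem_colon_ideal.1 hc
      obtain ⟨u, rfl⟩ := (hb c).1 (by rw [mul_comm]; exact hc' b hbK)
      exact ⟨u, (hPDmem u).2 fun k hkK => hc' k hkK, rfl⟩
    · rintro ⟨u, hu, rfl⟩
      exact mem_colon_ideal.2 ((hPDmem u).1 hu)
  have e1 : ∀ n, ExtVanish n C (C ⧸ K) C ↔ ExtVanish n D (D ⧸ KD) D := by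
    intro n
    rw [← extVanish_changeRings_iff hs hk' hD hv n]
    let e : (C ⧸ K) ≃ₗ[C] (D ⧸ KD) := LinearEquiv.ofBijective
      (K.liftQ ((KD.mkQ.restrictScalars C) ∘ₗ Algebra.linearMap C D)
        (fun k hk => (Submodule.Quotient.mk_eq_zero _).2 (Ideal.mem_map_of_mem _ hk))) (by
        constructor
        · rw [injective_iff_map_eq_zero]
          intro m hm
          obtain ⟨c, rfl⟩ := Submodule.Quotient.mk_surjective _ m
          rw [Submodule.Quotient.mk_eq_zero, ← hkerK]
          exact (Submodule.Quotient.mk_eq_zero KD).1 hm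
        · intro m
          obtain ⟨d, rfl⟩ := Submodule.Quotient.mk_surjective _ m
          obtain ⟨c, rfl⟩ := hs d
          exact ⟨Submodule.Quotient.mk c, rfl⟩)
    exact ⟨fun h => h.congr e, fun h => h.congr e.symm⟩
  have e2 : ∀ n, ExtVanish (n + 1) C (C ⧸ PC) C ↔ ExtVanish (n + 1) D (D ⧸ PD) D := by
    intro n
    let i : PD →ₗ[C] C := θ ∘ₗ PD.subtype.restrictScalars C
    rw [extVanish_succ_iff i PC.mkQ (hθi.comp (Submodule.injective_subtype _)) ?_
      PC.mkQ_surjective ExtVanish.of_projective, extVanish_succ_iff PD.subtype PD.mkQ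
      (Submodule.injective_subtype _) (LinearMap.exact_subtype_mkQ PD) PD.mkQ_surjective
      ExtVanish.of_projective]
    swap
    · intro c
      rw [Submodule.mkQ_apply, Submodule.Quotient.mk_eq_zero, hPCmem]
      constructor
      · rintro ⟨u, hu, rfl⟩
        exact ⟨⟨_, hu⟩, hθ u⟩
      · rintro ⟨⟨d, hd⟩, rfl⟩
        obtain ⟨u, rfl⟩ := hs d
        exact ⟨u, hd, hθ u⟩
    refine and_congr ⟨fun H φ' => ?_, fun H φ => ?_⟩
      (extVanish_changeRings_iff hs hk' hD hv n)
    · obtain ⟨ψ, hψ⟩ := H (θ ∘ₗ φ'.restrictScalars C)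
      refine ⟨LinearMap.mulLeft D (algebraMap C D (ψ 1)), LinearMap.ext fun v => hθi ?_⟩
      refine Eq.trans ?_ (LinearMap.congr_fun hψ v)
      obtain ⟨u, hu⟩ := hs v.1
      change θ (algebraMap C D (ψ 1) * v.1) = ψ (θ v.1)
      rw [← hu, ← map_mul, hθ, hθ]
      rw [← mul_one (a * u), ← smul_eq_mul (a * u), map_smul, smul_eq_mul]
      ring
    · have him : ∀ v, ∃ d, θ d = φ v := fun v => by
        obtain ⟨e, he⟩ := hD (φ v) (fun b hb => by
          rw [← smul_eq_mul, ← map_smul, ← algebraMap_smul D b v, (hk' b).2 hb, zero_smul, map_zero])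
        exact ⟨algebraMap C D e, (hθ e).trans he.symm⟩
      choose d hd using him
      let φ' : PD →ₗ[C] D :=
        { toFun := d
          map_add' := fun v w => hθi (by rw [map_add, hd, hd, hd, map_add])
          map_smul' := fun c v => hθi (by rw [hd, RingHom.id_apply, map_smul, map_smul, hd]) }
      obtain ⟨ψ', hψ'⟩ := H (LinearMap.extendScalarsOfSurjective hs φ')
      obtain ⟨e, he⟩ := hs (ψ' 1)
      refine ⟨LinearMap.mulLeft C e, LinearMap.ext fun v => ?_⟩
      obtain ⟨u, hu⟩ := hs v.1
      have h1 : d v = ψ' v.1 := (LinearMap.congr_fun hψ' v).symm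
      rw [← mul_one v.1, ← smul_eq_mul, map_smul, ← he, ← hu, smul_eq_mul, ← map_mul] at h1
      rw [← hd, h1, hθ]
      change e * θ v.1 = _
      rw [← hu, hθ]; ring
  have e2' : ∀ n, ExtVanish n C (C ⧸ PC) C ↔ ExtVanish n D (D ⧸ PD) D := by
    rintro (_ | n)
    · exact ⟨fun _ => extVanish_zero, fun _ => extVanish_zero⟩
    · exact e2 n
  have e3 : ∀ c, c ∈ (⊥ : Ideal C).colon (PC : Set C) ↔
      algebraMap C D c ∈ (⊥ : Ideal D).colon (PD : Set D) := by
    intro c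
    rw [mem_colon_ideal, mem_colon_ideal]
    constructor
    · intro h d hd
      obtain ⟨u, rfl⟩ := hs d
      rw [← map_mul, Ideal.mem_bot, hk', mul_left_comm]
      exact h _ ((hPCmem _).2 ⟨u, hd, rfl⟩)
    · intro h s hs'
      obtain ⟨u, hu, rfl⟩ := (hPCmem s).1 hs'
      have := h _ hu
      rwa [← map_mul, Ideal.mem_bot, hk', mul_left_comm] at this
  constructor
  · rintro ⟨h1, h2, h3⟩
    refine ⟨fun n => (e1 n).1 (h1 n), fun n => (e2' n).1 (h2 n), ?_⟩
    ext d
    obtain ⟨c, rfl⟩ := hs d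
    rw [← e3, hkerK, h3]
  · rintro ⟨h1, h2, h3⟩
    refine ⟨fun n => (e1 n).2 (h1 n), fun n => (e2' n).2 (h2 n), ?_⟩
    ext c
    rw [e3, h3, hkerK]
end

end

section
open RingTheory.Sequence

/-- `a` is a non-zero-divisor modulo `c`. -/
def NZD {B : Type} [CommRing B] (c : Ideal B) (a : B) : Prop := ∀ u, a * u ∈ c → u ∈ c

section
variable {B : Type} [CommRing B]

lemma nzd_iff_isSMulRegular {c : Ideal B} {a : B} : NZD c a ↔ IsSMulRegular (B ⧸ c) a := by
  rw [isSMulRegular_iff_right_eq_zero_of_smul]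
  constructor
  · intro h m hm
    obtain ⟨u, rfl⟩ := Submodule.Quotient.mk_surjective _ m
    rw [← Submodule.Quotient.mk_smul, Submodule.Quotient.mk_eq_zero] at hm
    exact (Submodule.Quotient.mk_eq_zero _).2 (h u hm)
  · intro h u hu
    exact (Submodule.Quotient.mk_eq_zero _).1 (h (Submodule.Quotient.mk u)
      ((Submodule.Quotient.mk_eq_zero _).2 hu))

lemma wreg_snoc {l : List B} {a : B} : IsWeaklyRegular B (l ++ [a]) ↔
    IsWeaklyRegular B l ∧ NZD (Ideal.ofList l) a := by
  rw [isWeaklyRegular_append_iff, isWeaklyRegular_singleton_iff, nzd_iff_isSMulRegular]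
  refine and_congr_right fun _ => ?_
  have : Ideal.ofList l • (⊤ : Submodule B B) = Ideal.ofList l := by simp
  rw [this]

lemma ofList_le {l : List B} {K : Ideal B} : Ideal.ofList l ≤ K ↔ ∀ a ∈ l, a ∈ K :=
  Ideal.span_le

lemma ofList_perm {l l' : List B} (h : l.Perm l') : Ideal.ofList l = Ideal.ofList l' := by
  unfold Ideal.ofList
  congr 1
  ext a
  exact h.mem_iff

lemma isRegular_iff_wreg {l : List B} :
    IsRegular B l ↔ IsWeaklyRegular B l ∧ Ideal.ofList l ≠ ⊤ := by
  rw [RingTheory.Sequence.isRegular_iff]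
  refine and_congr_right fun _ => ?_
  have : Ideal.ofList l • (⊤ : Submodule B B) = Ideal.ofList l := by simp
  rw [this]
  exact ne_comm

lemma nzd_iff_associatedPrimes [IsNoetherianRing B] {c : Ideal B} {a : B} :
    NZD c a ↔ ∀ p ∈ associatedPrimes B (B ⧸ c), a ∉ p := by
  have h := biUnion_associatedPrimes_eq_zero_divisors B (B ⧸ c)
  have h2 : (∃ p ∈ associatedPrimes B (B ⧸ c), a ∈ p) ↔ ∃ x : B ⧸ c, x ≠ 0 ∧ a • x = 0 := by
    have := Set.ext_iff.1 h a
    simpa using this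
  rw [nzd_iff_isSMulRegular, isSMulRegular_iff_right_eq_zero_of_smul]
  constructor
  · intro H p hp ha
    obtain ⟨x, hx, hx'⟩ := h2.1 ⟨p, hp, ha⟩
    exact hx (H x hx')
  · intro H x hx
    by_contra hne
    obtain ⟨p, hp, ha⟩ := h2.2 ⟨x, hne, hx⟩
    exact H p hp ha

/-- Prime avoidance for a finite set of primes. -/
lemma exists_mem_avoid {K : Ideal B} {S : Set (Ideal B)} (hS : S.Finite)
    (hp : ∀ p ∈ S, p.IsPrime) (h : ∀ p ∈ S, ¬ K ≤ p) : ∃ z ∈ K, ∀ p ∈ S, z ∉ p := by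
  by_contra! H
  have := (Ideal.subset_union_prime (s := hS.toFinset) (f := id) ⊥ ⊥
    (fun i hi _ _ => hp i (hS.mem_toFinset.1 hi)) (I := K)).1 (fun z hz => by
      obtain ⟨p, hpS, hzp⟩ := H z hz
      simp only [Set.mem_iUnion]
      exact ⟨p, by simpa using hpS, hzp⟩)
  obtain ⟨p, hpS, hKp⟩ := this
  exact h p (hS.mem_toFinset.1 hpS) hKp

lemma associatedPrimes_avoid [IsNoetherianRing B] {c K : Ideal B} {a : B} (ha : a ∈ K)
    (h : NZD c a) : ∀ p ∈ associatedPrimes B (B ⧸ c), ¬ K ≤ p :=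
  fun p hp hK => nzd_iff_associatedPrimes.1 h p hp (hK ha)

lemma exists_nzd_two [IsNoetherianRing B] {c c' K : Ideal B} {a b : B} (ha : a ∈ K) (hb : b ∈ K)
    (hca : NZD c a) (hcb : NZD c' b) : ∃ z ∈ K, NZD c z ∧ NZD c' z := by
  obtain ⟨z, hz, hzS⟩ := exists_mem_avoid (K := K)
    (S := associatedPrimes B (B ⧸ c) ∪ associatedPrimes B (B ⧸ c'))
    ((associatedPrimes.finite B _).union (associatedPrimes.finite B _))
    (by rintro p (hp | hp) <;> exact hp.isPrime)
    (by
      rintro p (hp | hp)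
      · exact associatedPrimes_avoid ha hca p hp
      · exact associatedPrimes_avoid hb hcb p hp)
  exact ⟨z, hz, nzd_iff_associatedPrimes.2 fun p hp => hzS p (Or.inl hp),
    nzd_iff_associatedPrimes.2 fun p hp => hzS p (Or.inr hp)⟩

variable [IsLocalRing B] [IsNoetherianRing B]

lemma wreg_perm {l l' : List B} (hm : ∀ a ∈ l, a ∈ IsLocalRing.maximalIdeal B)
    (h : IsWeaklyRegular B l) (hp : l.Perm l') : IsWeaklyRegular B l' :=
  IsLocalRing.isWeaklyRegular_of_perm_of_subset_maximalIdeal h hp hm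

/-- A property of ideals generated by regular sequences which is stable under exchanging the last
element only depends on the length of the sequence. -/
lemma exchange {K : Ideal B} (hK : K ≤ IsLocalRing.maximalIdeal B) (Q : Ideal B → Prop)
    (hQ : ∀ (zs : List B) (a b : B), (∀ x ∈ zs, x ∈ K) → a ∈ K → b ∈ K → NZD (Ideal.ofList zs) a →
      NZD (Ideal.ofList zs) b → Q (Ideal.ofList zs ⊔ Ideal.span {a}) →
      Q (Ideal.ofList zs ⊔ Ideal.span {b})) (n : ℕ) :
    ∀ (zs α β : List B), α.length = n → β.length = n → (∀ x ∈ zs, x ∈ K) → (∀ x ∈ α, x ∈ K) →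
      (∀ x ∈ β, x ∈ K) → IsWeaklyRegular B (zs ++ α) → IsWeaklyRegular B (zs ++ β) →
      Q (Ideal.ofList (zs ++ α)) → Q (Ideal.ofList (zs ++ β)) := by
  induction n with
  | zero =>
    intro zs α β hα hβ _ _ _ _ _ h
    rw [List.length_eq_zero_iff] at hα hβ
    subst hα hβ
    exact h
  | succ n ih =>
    intro zs α β hα hβ hzs hαK hβK hrα hrβ h
    obtain ⟨α, a, rfl⟩ := List.eq_nil_or_concat' α |>.resolve_left (by rintro rfl; simp at hα)
    obtain ⟨β, b, rfl⟩ := List.eq_nil_or_concat' β |>.resolve_left (by rintro rfl; simp at hβ)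
    simp only [List.length_append, List.length_singleton, Nat.add_right_cancel_iff] at hα hβ
    simp only [List.mem_append, List.mem_singleton, or_imp, forall_and, forall_eq] at hαK hβK
    rw [← List.append_assoc, wreg_snoc] at hrα hrβ
    rw [← List.append_assoc, Ideal.ofList_append, Ideal.ofList_singleton] at h ⊢
    obtain ⟨z, hzK, hz1, hz2⟩ := exists_nzd_two hαK.2 hβK.2 hrα.2 hrβ.2
    have hmem : ∀ α : List B, (∀ x ∈ α, x ∈ K) → ∀ x ∈ zs ++ α, x ∈ K := fun α hα x hx =>
      (List.mem_append.1 hx).elim (hzs x) (hα x)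
    have hmem' : ∀ α : List B, (∀ x ∈ α, x ∈ K) → ∀ x ∈ zs ++ α ++ [z], x ∈ K :=
      fun α hα x hx => (List.mem_append.1 hx).elim (hmem α hα x) fun h => by
        rw [List.mem_singleton.1 h]; exact hzK
    have hperm : ∀ α : List B, (zs ++ α ++ [z]).Perm (zs ++ [z] ++ α) := fun α => by
      rw [List.append_assoc, List.append_assoc]
      exact List.Perm.append_left _ List.perm_append_comm
    have h1 := hQ _ a z (hmem α hαK.1) hαK.2 hzK hrα.2 hz1 h
    refine hQ _ z b (hmem β hβK.1) hzK hβK.2 hz2 hrβ.2 ?_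
    rw [← Ideal.ofList_singleton, ← Ideal.ofList_append, ofList_perm (hperm _)] at h1 ⊢
    refine ih (zs ++ [z]) α β hα hβ (fun x hx => hmem' [] (by simp) x (by simpa using hx)) hαK.1
      hβK.1 ?_ ?_ h1
    · exact wreg_perm (fun x hx => hK (hmem' α hαK.1 x hx)) (wreg_snoc.2 ⟨hrα.1, hz1⟩) (hperm _)
    · exact wreg_perm (fun x hx => hK (hmem' β hβK.1 x hx)) (wreg_snoc.2 ⟨hrβ.1, hz2⟩) (hperm _)
end

section
variable {B : Type} [CommRing B]

lemma NZD.sub_mem {c : Ideal B} {a x y : B} (h : NZD c a) (hxy : a * x - a * y ∈ c) : x - y ∈ c :=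
  h _ (by rwa [mul_sub])

lemma mem_sup_span_singleton {c : Ideal B} {a x : B} :
    x ∈ c ⊔ Ideal.span {a} ↔ ∃ y, x - a * y ∈ c := by
  rw [Submodule.mem_sup]
  constructor
  · rintro ⟨z, hz, w, hw, rfl⟩
    obtain ⟨r, rfl⟩ := Ideal.mem_span_singleton.1 hw
    exact ⟨r, by convert hz using 1; ring⟩
  · rintro ⟨y, hy⟩
    exact ⟨_, hy, a * y, Ideal.mem_span_singleton.2 ⟨y, rfl⟩, by ring⟩

/-- The element obtained by transporting a socle element across an exchange. -/
lemma exchange_annihilator {c K : Ideal B} {a b u w : B} (ha : NZD c a) (hb : NZD c b)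
    (hw : u * b - a * w ∈ c) (huK : ∀ k ∈ K, u * k ∈ c ⊔ Ideal.span {a}) :
    (u ∉ c ⊔ Ideal.span {a} → w ∉ c ⊔ Ideal.span {b}) ∧ ∀ k ∈ K, w * k ∈ c ⊔ Ideal.span {b} := by
  constructor
  · intro hu hwb
    apply hu
    obtain ⟨y, hy⟩ := mem_sup_span_singleton.1 hwb
    refine mem_sup_span_singleton.2 ⟨y, hb.sub_mem ?_⟩
    have := add_mem hw (c.mul_mem_left a hy)
    convert this using 1; ring
  · intro k hk
    obtain ⟨v, hv⟩ := mem_sup_span_singleton.1 (huK k hk)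
    refine mem_sup_span_singleton.2 ⟨v, ha.sub_mem ?_⟩
    have := sub_mem (c.mul_mem_left b hv) (c.mul_mem_left k hw)
    convert this using 1; ring

/-- `c` has a one-dimensional socle with respect to the ideal `m`. -/
def SimpleSocle (m c : Ideal B) : Prop :=
  ∃ u, u ∉ c ∧ (∀ v ∈ m, u * v ∈ c) ∧ ∀ w, (∀ v ∈ m, w * v ∈ c) → ∃ r, w - u * r ∈ c

lemma SimpleSocle.exchange {c m : Ideal B} {a b : B} (ham : a ∈ m) (hbm : b ∈ m) (ha : NZD c a)
    (hb : NZD c b) (h : SimpleSocle m (c ⊔ Ideal.span {a})) :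
    SimpleSocle m (c ⊔ Ideal.span {b}) := by
  obtain ⟨u, hu, hum, hu'⟩ := h
  obtain ⟨w, hw⟩ := mem_sup_span_singleton.1 (hum b hbm)
  obtain ⟨h1, h2⟩ := exchange_annihilator ha hb hw hum
  refine ⟨w, h1 hu, h2, fun w' hw' => ?_⟩
  obtain ⟨v, hv⟩ := mem_sup_span_singleton.1 (hw' a ham)
  obtain ⟨r, hr⟩ := hu' v (exchange_annihilator hb ha hv hw').2
  obtain ⟨s, hs⟩ := mem_sup_span_singleton.1 hr
  refine ⟨r, mem_sup_span_singleton.2 ⟨s, ?_⟩⟩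
  rw [sub_sub]
  apply ha.sub_mem
  have := add_mem hv (add_mem (c.mul_mem_left b hs) (c.mul_mem_left r hw))
  convert this using 1; ring

/-- `GRefl` for the image of `K` in `B ⧸ c`. -/
def GMod (c K : Ideal B) : Prop := GRefl (B ⧸ c) (K.map (Ideal.Quotient.mk c))

lemma GMod_iff_of_nzd [IsNoetherianRing B] {c K : Ideal B} {a b : B} (ha : NZD c a) (hb : NZD c b)
    (haK : b ∈ K) : GMod (c ⊔ Ideal.span {a * b}) K ↔ GMod (c ⊔ Ideal.span {b}) K := by
  have hle : c ⊔ Ideal.span {a * b} ≤ c ⊔ Ideal.span {b} :=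
    sup_le_sup_left (by
      rw [Ideal.span_singleton_le_span_singleton]; exact dvd_mul_left b a) c
  let := (Ideal.Quotient.factor hle).toAlgebra
  have hs : Function.Surjective (algebraMap (B ⧸ c ⊔ Ideal.span {a * b}) (B ⧸ c ⊔ Ideal.span {b})) :=
    Ideal.Quotient.factor_surjective hle
  have hm : ∀ u, algebraMap (B ⧸ c ⊔ Ideal.span {a * b}) (B ⧸ c ⊔ Ideal.span {b})
      (Ideal.Quotient.mk _ u) = Ideal.Quotient.mk _ u := fun u => rfl
  have hdvd : ∀ x u : B, Ideal.Quotient.mk (c ⊔ Ideal.span {a * b}) x ∣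
      Ideal.Quotient.mk (c ⊔ Ideal.span {a * b}) u ↔ ∃ y z, u - x * y - a * b * z ∈ c := by
    intro x u
    constructor
    · rintro ⟨y, hy⟩
      obtain ⟨y, rfl⟩ := Ideal.Quotient.mk_surjective y
      rw [← map_mul, Ideal.Quotient.eq, mem_sup_span_singleton] at hy
      exact ⟨y, hy⟩
    · rintro ⟨y, hy⟩
      refine ⟨Ideal.Quotient.mk _ y, ?_⟩
      rw [← map_mul, Ideal.Quotient.eq, mem_sup_span_singleton]
      exact hy
  have key : ∀ a b : B, NZD c a → ∀ u, (∃ z, a * u - a * b * z ∈ c) ↔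
      ∃ y z, u - b * y - a * b * z ∈ c := by
    intro a b ha u
    constructor
    · rintro ⟨z, hz⟩
      exact ⟨z, 0, by rw [mul_zero, sub_zero]; exact ha.sub_mem (by convert hz using 1; ring)⟩
    · rintro ⟨y, z, h⟩
      exact ⟨y + a * z, by convert c.mul_mem_left a h using 1; ring⟩
  have := GRefl_iff_of_exact_pair hs (a := Ideal.Quotient.mk _ a) (b := Ideal.Quotient.mk _ b)
    (K := K.map (Ideal.Quotient.mk _)) ?_ ?_ ?_ (Ideal.mem_map_of_mem _ haK)
  · rw [Ideal.map_map] at this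
    exact this
  · intro u
    obtain ⟨u, rfl⟩ := Ideal.Quotient.mk_surjective u
    rw [hdvd, ← map_mul, Ideal.Quotient.eq_zero_iff_mem, mem_sup_span_singleton]
    exact key a b ha u
  · intro u
    obtain ⟨u, rfl⟩ := Ideal.Quotient.mk_surjective u
    rw [hdvd, ← map_mul, Ideal.Quotient.eq_zero_iff_mem, mem_sup_span_singleton, mul_comm a b]
    exact key b a hb u
  · intro u
    obtain ⟨u, rfl⟩ := Ideal.Quotient.mk_surjective u
    rw [hm, hdvd, Ideal.Quotient.eq_zero_iff_mem, mem_sup_span_singleton]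
    constructor
    · rintro ⟨y, hy⟩
      exact ⟨y, 0, by convert hy using 1; ring⟩
    · rintro ⟨y, z, h⟩
      exact ⟨y + a * z, by convert h using 1; ring⟩

lemma GMod.exchange [IsNoetherianRing B] {c K : Ideal B} {a b : B} (haK : a ∈ K) (hbK : b ∈ K)
    (ha : NZD c a) (hb : NZD c b) (h : GMod (c ⊔ Ideal.span {a}) K) :
    GMod (c ⊔ Ideal.span {b}) K := by
  rw [← GMod_iff_of_nzd hb ha haK] at h
  rw [← GMod_iff_of_nzd ha hb hbK, mul_comm]
  exact h

lemma forall_NZD_of_wreg {α : List B} : IsWeaklyRegular B α ↔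
    ∀ l < α.length, NZD (Ideal.ofList (α.take l)) (α.getD l 0) := by
  induction α using List.reverseRecOn with
  | nil => simp
  | append_singleton α a ih =>
    rw [wreg_snoc, ih]
    constructor
    · rintro ⟨h1, h2⟩ l hl
      rcases Nat.lt_or_ge l α.length with h | h
      · rw [List.take_append_of_le_length h.le, List.getD_append _ _ _ _ h]
        exact h1 l h
      · have : l = α.length := by simp at hl; omega
        subst this
        simpa using h2
    · intro h
      refine ⟨fun l hl => ?_, ?_⟩
      · have := h l (by simp; omega)
        rwa [List.take_append_of_le_length hl.le, List.getD_append _ _ _ _ hl] at this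
      · simpa using h α.length (by simp)

variable [IsLocalRing B] [IsNoetherianRing B]

/-- A regular sequence in `K` shorter than another one can be extended. -/
lemma exists_nzd_of_length_lt {K : Ideal B} (hK : K ≤ IsLocalRing.maximalIdeal B) {α c : List B}
    (hα : ∀ x ∈ α, x ∈ K) (hc : ∀ x ∈ c, x ∈ K) (hrα : IsWeaklyRegular B α)
    (hrc : IsWeaklyRegular B c) (hlt : c.length < α.length) : ∃ z ∈ K, NZD (Ideal.ofList c) z := by
  by_contra! H
  have h1 : ∃ p ∈ associatedPrimes B (B ⧸ Ideal.ofList c), K ≤ p := by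
    by_contra! h
    obtain ⟨z, hz, hz'⟩ := exists_mem_avoid (associatedPrimes.finite B (B ⧸ Ideal.ofList c))
      (fun p hp => hp.isPrime) h
    exact H z hz (nzd_iff_associatedPrimes.2 hz')
  obtain ⟨p, hp, hKp⟩ := h1
  obtain ⟨m, hm⟩ := ((isAssociatedPrime_iff).1 hp).2
  obtain ⟨u, rfl⟩ := Submodule.Quotient.mk_surjective _ m
  have hpu : ∀ k, k ∈ p ↔ u * k ∈ Ideal.ofList c := fun k => by
    rw [hm, Submodule.mem_colon_singleton, ← Submodule.Quotient.mk_smul, Submodule.mem_bot,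
      Submodule.Quotient.mk_eq_zero, smul_eq_mul, mul_comm]
  have h2 := exchange hK (fun c => ∃ u, u ∉ c ∧ ∀ k ∈ K, u * k ∈ c) (by
    rintro zs a b hzs ha hb hza hzb ⟨u, hu, huK⟩
    obtain ⟨w, hw⟩ := mem_sup_span_singleton.1 (huK b hb)
    have := exchange_annihilator hza hzb hw huK
    exact ⟨w, this.1 hu, this.2⟩) c.length [] c (α.take c.length) rfl
    (by rw [List.length_take]; omega) (by simp) hc (fun x hx => hα x (List.mem_of_mem_take hx))
    hrc ?_ ⟨u, fun hu => hp.isPrime.one_notMem ((hpu 1).2 (by simpa using hu)),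
      fun k hk => (hpu k).1 (hKp hk)⟩
  · obtain ⟨u, hu, huK⟩ := h2
    refine hu (forall_NZD_of_wreg.1 hrα c.length hlt u ?_)
    rw [mul_comm]
    apply huK
    rw [List.getD_eq_getElem _ _ hlt]
    exact hα _ (List.getElem_mem hlt)
  · rw [List.nil_append]
    rw [← List.take_append_drop c.length α, isWeaklyRegular_append_iff] at hrα
    exact hrα.1
end

section
variable {B : Type} [CommRing B]

lemma map_mk_colon (c K : Ideal B) : (c.colon (K : Set B)).map (Ideal.Quotient.mk c) =
    (⊥ : Ideal (B ⧸ c)).colon (K.map (Ideal.Quotient.mk c) : Set (B ⧸ c)) := by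
  refine le_antisymm ?_ fun d hd => ?_
  · have := map_colon_le (Ideal.Quotient.mk c) c K
    rwa [Ideal.map_quotient_self] at this
  · obtain ⟨a, rfl⟩ := Ideal.Quotient.mk_surjective d
    refine Ideal.mem_map_of_mem _ (mem_colon_ideal.2 fun k hk => ?_)
    have := mem_colon_ideal.1 hd _ (Ideal.mem_map_of_mem _ hk)
    rwa [← map_mul, Ideal.mem_bot, Ideal.Quotient.eq_zero_iff_mem] at this

lemma le_colon_self (c K : Ideal B) : c ≤ c.colon (K : Set B) := Ideal.le_colon

lemma eq_of_map_mk_eq {c I J : Ideal B} (hI : c ≤ I) (hJ : c ≤ J)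
    (h : I.map (Ideal.Quotient.mk c) = J.map (Ideal.Quotient.mk c)) : I = J := by
  have := congr_arg (Ideal.comap (Ideal.Quotient.mk c)) h
  rwa [Ideal.comap_map_of_surjective _ Ideal.Quotient.mk_surjective,
    Ideal.comap_map_of_surjective _ Ideal.Quotient.mk_surjective, ← RingHom.ker_eq_comap_bot,
    Ideal.mk_ker, sup_eq_left.2 hI, sup_eq_left.2 hJ] at this

lemma GMod.colon {c K : Ideal B} (h : GMod c K) : GMod c (c.colon (K : Set B)) := by
  unfold GMod
  rw [map_mk_colon]
  exact GRefl.perp h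

lemma GMod.colon_colon {c K : Ideal B} (h : GMod c K) (hc : c ≤ K) :
    c.colon (c.colon (K : Set B) : Set B) = K := by
  apply eq_of_map_mk_eq (le_colon_self _ _) hc
  rw [map_mk_colon, map_mk_colon]
  exact GRefl.perp_perp h

lemma GMod_top (c : Ideal B) : GMod c ⊤ := by
  unfold GMod
  rw [Ideal.map_top]
  have h1 : (⊥ : Ideal (B ⧸ c)).colon ((⊤ : Ideal (B ⧸ c)) : Set (B ⧸ c)) = ⊥ := by
    rw [Submodule.top_coe, Submodule.colon_univ]
  have h2 : (⊥ : Ideal (B ⧸ c)).colon ((⊥ : Ideal (B ⧸ c)) : Set (B ⧸ c)) = ⊤ :=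
    Submodule.colon_bot
  refine ⟨fun n => ?_, fun n => ?_, ?_⟩
  · have : Subsingleton ((B ⧸ c) ⧸ (⊤ : Ideal (B ⧸ c))) := Submodule.Quotient.subsingleton_iff.2 rfl
    exact ExtVanish.of_projective n
  · rw [h1]
    have : Module.Projective (B ⧸ c) ((B ⧸ c) ⧸ (⊥ : Ideal (B ⧸ c))) :=
      Module.Projective.of_equiv (Submodule.quotEquivOfEqBot _ rfl).symm
    exact ExtVanish.of_projective n
  · rw [h1, h2]

lemma ofList_map {T : Type} [CommRing T] (f : B →+* T) (l : List B) :
    Ideal.ofList (l.map f) = (Ideal.ofList l).map f := (Ideal.map_ofList f l).symm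

lemma mem_ofList_map {T : Type} [CommRing T] {f : B →+* T} {l : List B} {K : Ideal B}
    (h : ∀ x ∈ l, x ∈ K) : ∀ x ∈ l.map f, x ∈ K.map f := by
  intro y hy
  obtain ⟨x, hx, rfl⟩ := List.mem_map.1 hy
  exact Ideal.mem_map_of_mem _ (h x hx)

/-- Every regular sequence of length `g` in `K` defines a linked pair of totally reflexive
quotients. -/
def GPerf (g : ℕ) (K : Ideal B) : Prop :=
  ∀ β : List B, β.length = g → (∀ x ∈ β, x ∈ K) → IsRegular B β → GMod (Ideal.ofList β) K

lemma NZD_map_iff {T : Type} [CommRing T] {f : B →+* T} (hf : Function.Surjective f)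
    {x : B} (hk : ∀ a, f a = 0 ↔ x ∣ a) {c : Ideal B} {a : B} :
    NZD (c.map f) (f a) ↔ NZD (c ⊔ Ideal.span {x}) a := by
  have h : ∀ u, f u ∈ c.map f ↔ u ∈ c ⊔ Ideal.span {x} := fun u => by
    rw [mem_sup_span_singleton, Ideal.mem_map_iff_of_surjective _ hf]
    constructor
    · rintro ⟨v, hv, hvu⟩
      obtain ⟨y, hy⟩ := (hk (u - v)).1 (by rw [map_sub, hvu, sub_self])
      exact ⟨y, by rw [← hy]; simpa using hv⟩
    · rintro ⟨y, hy⟩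
      exact ⟨_, hy, by rw [map_sub, (hk (x * y)).2 ⟨y, rfl⟩, sub_zero]⟩
  constructor
  · intro H u hu
    rw [← h] at hu ⊢
    exact H _ (by rwa [← map_mul])
  · intro H u hu
    obtain ⟨u, rfl⟩ := hf u
    rw [← map_mul] at hu
    rw [h] at hu ⊢
    exact H u hu

lemma wreg_cons_iff {T : Type} [CommRing T] {f : B →+* T} (hf : Function.Surjective f)
    {x : B} (hx : NZD ⊥ x) (hk : ∀ a, f a = 0 ↔ x ∣ a) {β : List B} :
    IsWeaklyRegular B (x :: β) ↔ IsWeaklyRegular T (β.map f) := by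
  induction β using List.reverseRecOn with
  | nil =>
    rw [← List.nil_append [x], wreg_snoc]
    simpa using hx
  | append_singleton β a ih =>
    rw [← List.cons_append, wreg_snoc, ih, List.map_append, List.map_singleton, wreg_snoc,
      ofList_map, NZD_map_iff hf hk, Ideal.ofList_cons, sup_comm]

variable [IsLocalRing B]

lemma mem_maximalIdeal_of_isRegular {β : List B} (h : IsRegular B β) :
    ∀ x ∈ β, x ∈ IsLocalRing.maximalIdeal B :=
  ofList_le.1 (IsLocalRing.le_maximalIdeal (isRegular_iff_wreg.1 h).2)

lemma isRegular_iff_wreg' {β : List B} :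
    IsRegular B β ↔ IsWeaklyRegular B β ∧ ∀ x ∈ β, x ∈ IsLocalRing.maximalIdeal B := by
  rw [isRegular_iff_wreg, ← ofList_le]
  exact and_congr_right fun _ => ⟨IsLocalRing.le_maximalIdeal, fun h h' =>
    Ideal.IsPrime.ne_top' (top_unique (h'.symm.le.trans h))⟩

variable [IsNoetherianRing B]

lemma GPerf_iff_of_isRegular {g : ℕ} {K : Ideal B} {α : List B} (hl : α.length = g)
    (hα : ∀ x ∈ α, x ∈ K) (hr : IsRegular B α) : GPerf g K ↔ GMod (Ideal.ofList α) K := by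
  refine ⟨fun h => h α hl hα hr, fun h β hβl hβ hrβ => ?_⟩
  exact exchange (K := K ⊓ IsLocalRing.maximalIdeal B) inf_le_right (fun c => GMod c K)
    (fun zs a b _ ha hb hza hzb h => h.exchange ha.1 hb.1 hza hzb) g [] α β hl hβl (by simp)
    (fun x hx => ⟨hα x hx, mem_maximalIdeal_of_isRegular hr x hx⟩)
    (fun x hx => ⟨hβ x hx, mem_maximalIdeal_of_isRegular hrβ x hx⟩)
    (isRegular_iff_wreg.1 hr).1 (isRegular_iff_wreg.1 hrβ).1 h

lemma GPerf.colon {g : ℕ} {K : Ideal B} (h : GPerf g K) {α : List B} (hl : α.length = g)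
    (hα : ∀ x ∈ α, x ∈ K) (hr : IsRegular B α) :
    GPerf g ((Ideal.ofList α).colon (K : Set B)) :=
  (GPerf_iff_of_isRegular hl (ofList_le.1 (le_colon_self _ _)) hr).2 (h α hl hα hr).colon

omit [IsLocalRing B] [IsNoetherianRing B] in
lemma GPerf.colon_colon {g : ℕ} {K : Ideal B} (h : GPerf g K) {α : List B} (hl : α.length = g)
    (hα : ∀ x ∈ α, x ∈ K) (hr : IsRegular B α) :
    (Ideal.ofList α).colon ((Ideal.ofList α).colon (K : Set B) : Set B) = K :=
  (h α hl hα hr).colon_colon (ofList_le.2 hα)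

/-- A complete intersection defining a proper direct link has length `g`. -/
lemma GPerf.length_eq {g : ℕ} {K : Ideal B} (h : GPerf g K) (hK : K ≠ ⊤) {α c : List B}
    (hl : α.length = g) (hα : ∀ x ∈ α, x ∈ K) (hr : IsRegular B α) (hc : ∀ x ∈ c, x ∈ K)
    (hrc : IsRegular B c) (hne : (Ideal.ofList c).colon (K : Set B) ≠ Ideal.ofList c) :
    c.length = g := by
  rcases lt_trichotomy c.length g with hlt | heq | hgt
  · obtain ⟨z, hz, hzc⟩ := exists_nzd_of_length_lt (IsLocalRing.le_maximalIdeal hK) hα hc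
      (isRegular_iff_wreg.1 hr).1 (isRegular_iff_wreg.1 hrc).1 (by omega)
    refine absurd (le_antisymm (fun u hu => hzc u ?_) (le_colon_self _ _)) hne
    rw [mul_comm]
    exact mem_colon_ideal.1 hu z hz
  · exact heq
  · have hw := (isRegular_iff_wreg.1 hrc).1
    have hn := forall_NZD_of_wreg.1 hw g hgt
    have hwt : IsRegular B (c.take g) := isRegular_iff_wreg'.2 ⟨by
      rw [← List.take_append_drop g c, isWeaklyRegular_append_iff] at hw
      exact hw.1, fun x hx => mem_maximalIdeal_of_isRegular hrc x (List.mem_of_mem_take hx)⟩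
    have h1 := h.colon_colon (α := c.take g) (by rw [List.length_take]; omega)
      (fun x hx => hc x (List.mem_of_mem_take hx)) hwt
    have h2 : (Ideal.ofList (c.take g)).colon (K : Set B) = Ideal.ofList (c.take g) := by
      refine le_antisymm (fun u hu => hn u ?_) (le_colon_self _ _)
      rw [mul_comm]
      refine mem_colon_ideal.1 hu _ ?_
      rw [List.getD_eq_getElem _ _ hgt]
      exact hc _ (List.getElem_mem hgt)
    rw [h2] at h1
    refine absurd ?_ hK
    rw [← h1, Submodule.colon_eq_top_iff_subset]

omit [IsLocalRing B] in
lemma GMod.map_of_flat {T : Type} [CommRing T] [Algebra B T] [Module.Flat B T] {c K : Ideal B}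
    (h : GMod c K) : GMod (c.map (algebraMap B T)) (K.map (algebraMap B T)) := by
  have : Module.Flat (B ⧸ c) (T ⧸ c.map (algebraMap B T)) :=
    Module.Flat.of_linearEquiv (Algebra.TensorProduct.quotIdealMapEquivQuotTensor T c).toLinearEquiv
  have h2 := GRefl.map_of_flat (A' := T ⧸ c.map (algebraMap B T)) h
  rw [Ideal.map_map] at h2
  unfold GMod
  rw [Ideal.map_map]
  exact h2

omit [IsLocalRing B] [IsNoetherianRing B] in
lemma isRegular_map_of_flat {T : Type} [CommRing T] [Algebra B T] [Module.Flat B T]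
    {α : List B} (hr : IsRegular B α) (hT : (Ideal.ofList α).map (algebraMap B T) ≠ ⊤) :
    IsRegular T (α.map (algebraMap B T)) := by
  rw [isRegular_iff_wreg, ofList_map]
  exact ⟨IsWeaklyRegular.of_flat (isRegular_iff_wreg.1 hr).1, hT⟩

omit [IsLocalRing B] in
lemma GPerf.map_of_flat {T : Type} [CommRing T] [IsLocalRing T] [IsNoetherianRing T] [Algebra B T]
    [Module.Flat B T] {g : ℕ} {K : Ideal B} (h : GPerf g K) {α : List B} (hl : α.length = g)
    (hα : ∀ x ∈ α, x ∈ K) (hr : IsRegular B α) : GPerf g (K.map (algebraMap B T)) := by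
  by_cases hT : (Ideal.ofList α).map (algebraMap B T) = ⊤
  · have : K.map (algebraMap B T) = ⊤ :=
      top_unique (hT.symm.le.trans (Ideal.map_mono (ofList_le.2 hα)))
    rw [this]
    exact fun β _ _ _ => GMod_top _
  · refine (GPerf_iff_of_isRegular (by rw [List.length_map, hl]) (mem_ofList_map hα)
      (isRegular_map_of_flat hr hT)).2 ?_
    rw [ofList_map]
    exact (h α hl hα hr).map_of_flat
end

section
variable {B T : Type} [CommRing B] [CommRing T]

/-- A surjection along which regular sequences lift, and links of `GPerf` ideals specialize. -/
structure SpecMap (f : B →+* T) : Prop where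
  surj : Function.Surjective f
  reg : ∀ β : List B, IsRegular T (β.map f) → IsRegular B β
  perf : ∀ (K : Ideal B) (β : List B), (∀ x ∈ β, x ∈ K) → IsRegular T (β.map f) →
    GPerf β.length K → GPerf β.length (K.map f)
  colon : ∀ (K : Ideal B) (β : List B), (∀ x ∈ β, x ∈ K) → IsRegular T (β.map f) →
    GPerf β.length K → ((Ideal.ofList β).colon (K : Set B)).map f =
      (Ideal.ofList (β.map f)).colon (K.map f : Set T)

lemma SpecMap.id : SpecMap (RingHom.id B) where
  surj := Function.surjective_id
  reg β h := by simpa using h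
  perf K β _ _ h := by rwa [Ideal.map_id]
  colon K β _ _ h := by
    rw [Ideal.map_id, Ideal.map_id]
    simp

lemma SpecMap.comp {C : Type} [CommRing C] {f : B →+* T} {g : C →+* B} (hf : SpecMap f)
    (hg : SpecMap g) : SpecMap (f.comp g) := by
  have hm : ∀ β : List C, β.map (f.comp g) = (β.map g).map f := fun β => by
    rw [List.map_map]; rfl
  refine ⟨hf.surj.comp hg.surj, fun β h => ?_, fun K β hβ h hp => ?_, fun K β hβ h hp => ?_⟩
  · exact hg.reg _ (hf.reg _ (by rwa [← hm]))
  · rw [hm] at h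
    have h1 := hg.perf K β hβ (hf.reg _ h) hp
    have h2 := hf.perf (K.map g) (β.map g) (mem_ofList_map hβ) h (by rwa [List.length_map])
    rwa [List.length_map, Ideal.map_map] at h2
  · rw [hm] at h
    have h1 := hg.perf K β hβ (hf.reg _ h) hp
    rw [hm, ← Ideal.map_map, ← Ideal.map_map, hg.colon K β hβ (hf.reg _ h) hp]
    exact hf.colon (K.map g) (β.map g) (mem_ofList_map hβ) h (by rwa [List.length_map])

variable [IsLocalRing B] [IsNoetherianRing B] [IsLocalRing T] [IsNoetherianRing T]

lemma SpecMap.of_ker_eq_span {f : B →+* T} (hf : Function.Surjective f) {x : B}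
    (hx : NZD ⊥ x) (hk : ∀ a, f a = 0 ↔ x ∣ a) : SpecMap f := by
  have hxm : x ∈ IsLocalRing.maximalIdeal B := fun hu => by
    have := hu.map f
    rw [(hk x).2 dvd_rfl] at this
    exact not_isUnit_zero this
  have hwr : ∀ β : List B, IsRegular T (β.map f) → IsWeaklyRegular B (β ++ [x]) ∧
      ∀ x ∈ β, x ∈ IsLocalRing.maximalIdeal B := fun β h => by
    have hm : ∀ x ∈ β, x ∈ IsLocalRing.maximalIdeal B := fun y hy => by
      have := mem_maximalIdeal_of_isRegular h (f y) (List.mem_map_of_mem hy)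
      exact fun hu => this (hu.map f)
    have hw := (wreg_cons_iff hf hx hk).2 (isRegular_iff_wreg.1 h).1
    exact ⟨wreg_perm (List.forall_mem_cons.2 ⟨hxm, hm⟩) hw (List.perm_append_singleton x β).symm, hm⟩
  have key : ∀ (K : Ideal B) (β : List B), (∀ x ∈ β, x ∈ K) → IsRegular T (β.map f) →
      GMod (Ideal.ofList β) K → GMod (Ideal.ofList (β.map f)) (K.map f) ∧
      ((Ideal.ofList β).colon (K : Set B)).map f =
      (Ideal.ofList (β.map f)).colon (K.map f : Set T) := fun K β hβ h hK => by
    have hnz := (wreg_snoc.1 (hwr β h).1).2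
    rw [ofList_map]
    set c := Ideal.ofList β
    let q : B ⧸ c →+* T ⧸ c.map f := Ideal.quotientMap _ f Ideal.le_comap_map
    let : Algebra (B ⧸ c) (T ⧸ c.map f) := q.toAlgebra
    have hq : ∀ L : Ideal B, (L.map (Ideal.Quotient.mk c)).map (algebraMap (B ⧸ c) (T ⧸ c.map f)) =
        (L.map f).map (Ideal.Quotient.mk (c.map f)) := fun L => by
      rw [Ideal.map_map, Ideal.map_map]; rfl
    have hqs : Function.Surjective (algebraMap (B ⧸ c) (T ⧸ c.map f)) := by
      intro y
      obtain ⟨y, rfl⟩ := Ideal.Quotient.mk_surjective y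
      obtain ⟨y, rfl⟩ := hf y
      exact ⟨Ideal.Quotient.mk c y, rfl⟩
    have hx' : ∀ a, Ideal.Quotient.mk c x * a = 0 → a = 0 := fun a ha => by
      obtain ⟨a, rfl⟩ := Ideal.Quotient.mk_surjective a
      rw [← map_mul, Ideal.Quotient.eq_zero_iff_mem] at ha
      exact Ideal.Quotient.eq_zero_iff_mem.2 (hnz _ ha)
    have hk' : ∀ a, algebraMap (B ⧸ c) (T ⧸ c.map f) a = 0 ↔ Ideal.Quotient.mk c x ∣ a := by
      intro a
      obtain ⟨a, rfl⟩ := Ideal.Quotient.mk_surjective a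
      have h0 : algebraMap (B ⧸ c) (T ⧸ c.map f) (Ideal.Quotient.mk c a) =
        Ideal.Quotient.mk (c.map f) (f a) := rfl
      rw [h0, Ideal.Quotient.eq_zero_iff_mem, Ideal.mem_map_iff_of_surjective _ hf]
      constructor
      · rintro ⟨v, hv, hva⟩
        obtain ⟨y, hy⟩ := (hk (a - v)).1 (by rw [map_sub, hva, sub_self])
        refine ⟨Ideal.Quotient.mk c y, ?_⟩
        rw [← map_mul, ← hy, Ideal.Quotient.eq]
        simpa using hv
      · rintro ⟨y, hy⟩
        obtain ⟨y, rfl⟩ := Ideal.Quotient.mk_surjective y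
        rw [← map_mul, Ideal.Quotient.eq] at hy
        exact ⟨_, hy, by rw [map_sub, (hk (x * y)).2 ⟨y, rfl⟩, sub_zero]⟩
    have h1 := GRefl.specialize hqs hx' hk' hK
    have h2 := colon_map_of_extVanish hqs hx' hk' (GRefl.ext hK 1)
    rw [hq] at h1
    refine ⟨h1, ?_⟩
    rw [hq, ← map_mk_colon, ← map_mk_colon, hq] at h2
    exact (eq_of_map_mk_eq (le_colon_self _ _) (Ideal.map_mono (le_colon_self _ _)) h2).symm
  have hreg : ∀ β : List B, IsRegular T (β.map f) → IsRegular B β := fun β h =>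
    isRegular_iff_wreg'.2 ⟨(wreg_snoc.1 (hwr β h).1).1, (hwr β h).2⟩
  refine ⟨hf, hreg, fun K β hβ h hp => ?_, fun K β hβ h hp => ?_⟩
  · exact (GPerf_iff_of_isRegular (by rw [List.length_map]) (mem_ofList_map hβ) h).2
      (key K β hβ h (hp β rfl hβ (hreg β h))).1
  · exact (key K β hβ h (hp β rfl hβ (hreg β h))).2
end

lemma Polynomial.mapRingHom_flat {S B : Type} [CommRing S] [CommRing B] {f : S →+* B} (hf : f.Flat) :
    (Polynomial.mapRingHom f).Flat := by
  algebraize [f]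
  let : Algebra (Polynomial S) (Polynomial B) := Polynomial.algebra S B
  exact RingHom.Flat.isStableUnderBaseChange S B (Polynomial S) (Polynomial B) hf

lemma Polynomial.C_flat (S : Type) [CommRing S] : (Polynomial.C : S →+* Polynomial S).Flat := by
  have : (algebraMap S (Polynomial S)).Flat := RingHom.flat_algebraMap_iff.2 inferInstance
  exact this

/-- `𝒦` specializes along `φ` as if `φ` were a base change by a flat map followed by `SpecMap`. -/
structure LiftsAlong {S T : Type} [CommRing S] [CommRing T] (g : ℕ) (K : Ideal S)
    (φ : S →+* T) : Prop where
  factor : ∃ (B : Type) (_ : CommRing B) (_ : IsLocalRing B) (_ : IsNoetherianRing B)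
    (h : S →+* B) (f : B →+* T), h.Flat ∧ SpecMap f ∧ f.comp h = φ
  perf : ∀ (B : Type) [CommRing B] [IsLocalRing B] [IsNoetherianRing B] (h : S →+* B)
    (f : B →+* T), h.Flat → SpecMap f → f.comp h = φ → GPerf g (K.map h)

section
variable {S T : Type} [CommRing S] [CommRing T] {g : ℕ} {K : Ideal S} {φ : S →+* T}

lemma LiftsAlong.colon (H : LiftsAlong g K φ) (hK : K.FG) {β : List S} (hl : β.length = g)
    (hβ : ∀ x ∈ β, x ∈ K) (hr : IsRegular T (β.map φ)) :
    LiftsAlong g ((Ideal.ofList β).colon (K : Set S)) φ ∧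
    ((Ideal.ofList β).colon (K : Set S)).map φ =
      (Ideal.ofList (β.map φ)).colon (K.map φ : Set T) := by
  have hm : ∀ (B : Type) [CommRing B] (h : S →+* B), h.Flat →
      ((Ideal.ofList β).colon (K : Set S)).map h =
      (Ideal.ofList (β.map h)).colon (K.map h : Set B) := fun B _ h hh => by
    algebraize [h]
    have := map_colon_of_flat (A' := B) (Ideal.ofList β) K hK
    rw [ofList_map]
    exact this
  constructor
  · refine ⟨H.factor, ?_⟩
    intro B _ _ _ h f hh hf hfh
    rw [hm B h hh]
    subst hfh
    exact (H.perf B h f hh hf rfl).colon (by rw [List.length_map, hl]) (mem_ofList_map hβ)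
      (hf.reg _ (by rwa [List.map_map]))
  · obtain ⟨B, _, _, _, h, f, hh, hf, rfl⟩ := H.factor
    have h1 := H.perf B h f hh hf rfl
    subst hl
    have := hf.colon (K.map h) (β.map h) (mem_ofList_map hβ) (by rwa [List.map_map])
      (by rwa [List.length_map])
    rwa [← hm B h hh, Ideal.map_map, Ideal.map_map, List.map_map] at this

lemma LiftsAlong.of_flat [IsLocalRing S] [IsNoetherianRing S] [IsLocalRing T] [IsNoetherianRing T]
    (hφ : φ.Flat) (hK : GPerf g K) {α : List S} (hl : α.length = g)
    (hα : ∀ x ∈ α, x ∈ K) (hr : IsRegular S α) : LiftsAlong g K φ where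
  factor := ⟨T, _, inferInstance, inferInstance, φ, RingHom.id T, hφ, SpecMap.id, rfl⟩
  perf B _ _ _ h f hh hf hfh := by
    algebraize [h]
    exact hK.map_of_flat hl hα hr

lemma SpecMap.exists_lift_polynomial {B : Type} [CommRing B] [IsLocalRing B] [IsNoetherianRing B]
    (b : B) : ∃ (B' : Type) (_ : CommRing B') (_ : IsLocalRing B') (_ : IsNoetherianRing B')
    (h : Polynomial B →+* B') (f : B' →+* B), h.Flat ∧ SpecMap f ∧
      f.comp h = Polynomial.evalRingHom b := by
  let P : Ideal (Polynomial B) :=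
    (IsLocalRing.maximalIdeal B).comap (Polynomial.evalRingHom b)
  have hP : ∀ y : P.primeCompl, IsUnit (Polynomial.evalRingHom b y) := fun y => by
    by_contra hy
    exact y.2 hy
  let f : Localization.AtPrime P →+* B := IsLocalization.lift (M := P.primeCompl) hP
  have hf : f.comp (algebraMap _ _) = Polynomial.evalRingHom b := IsLocalization.lift_comp hP
  have hfe : ∀ p : Polynomial B, f (algebraMap _ _ p) = p.eval b := fun p => RingHom.congr_fun hf p
  refine ⟨Localization.AtPrime P, inferInstance, inferInstance, inferInstance, algebraMap _ _, f,
    RingHom.flat_algebraMap_iff.2 (IsLocalization.flat _ P.primeCompl), ?_, hf⟩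
  have hnz : (Polynomial.X - Polynomial.C b) ∈ nonZeroDivisors (Polynomial B) :=
    (Polynomial.monic_X_sub_C b).mem_nonZeroDivisors
  refine SpecMap.of_ker_eq_span (x := algebraMap _ _ (Polynomial.X - Polynomial.C b))
    (fun y => ⟨algebraMap _ _ (Polynomial.C y), by rw [hfe, Polynomial.eval_C]⟩) ?_ ?_
  · intro a ha
    have := IsLocalization.map_nonZeroDivisors_le P.primeCompl (Localization.AtPrime P)
      (Submonoid.mem_map_of_mem _ hnz)
    exact (mem_nonZeroDivisors_iff.1 this).1 a ha
  · intro a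
    constructor
    · intro ha
      obtain ⟨p, s, rfl⟩ := IsLocalization.exists_mk'_eq P.primeCompl a
      have h1 : p.eval b = 0 := by
        rw [← hfe, ← IsLocalization.mk'_spec' (Localization.AtPrime P) p s, map_mul, ha, mul_zero]
      obtain ⟨q, rfl⟩ := Polynomial.dvd_iff_isRoot.2 h1
      exact ⟨IsLocalization.mk' _ q s, by rw [IsLocalization.mul_mk'_eq_mk'_of_mul]⟩
    · rintro ⟨y, rfl⟩
      rw [map_mul, hfe]
      simp

lemma LiftsAlong.polynomial [IsLocalRing T] [IsNoetherianRing T]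
    {ψ : Polynomial S →+* T} (H : LiftsAlong g K (ψ.comp Polynomial.C)) :
    LiftsAlong g (K.map (Polynomial.C : S →+* Polynomial S)) ψ where
  factor := by
    obtain ⟨B, _, _, _, h, f, hh, hf, hfh⟩ := H.factor
    obtain ⟨b, hb⟩ := hf.surj (ψ Polynomial.X)
    obtain ⟨B', _, _, _, h', f', hh', hf', hfh'⟩ := SpecMap.exists_lift_polynomial b
    refine ⟨B', inferInstance, inferInstance, inferInstance, h'.comp (Polynomial.mapRingHom h),
      f.comp f', (Polynomial.mapRingHom_flat hh).comp hh', hf.comp hf', ?_⟩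
    rw [RingHom.comp_assoc, ← RingHom.comp_assoc _ h' f', hfh']
    refine Polynomial.ringHom_ext (fun a => ?_) ?_
    · simpa using RingHom.congr_fun hfh a
    · simpa using hb
  perf B _ _ _ h f hh hf hfh := by
    rw [Ideal.map_map]
    exact H.perf B _ f ((Polynomial.C_flat S).comp hh) hf (by rw [← hfh, RingHom.comp_assoc])
end

lemma coeff_mem_of_eval_mem {R : Type} [CommRing R] [IsLocalRing R]
    [Infinite (IsLocalRing.ResidueField R)] {J : Ideal R} {F : Polynomial R}
    {E : Set (IsLocalRing.ResidueField R)} (hE : E.Finite)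
    (h : ∀ y, IsLocalRing.residue R y ∉ E → F.eval y ∈ J) (i : ℕ) : F.coeff i ∈ J := by
  obtain ⟨s, hs, hcard⟩ := hE.infinite_compl.exists_subset_card_eq (F.natDegree + 1)
  obtain ⟨σ, hσ⟩ := (IsLocalRing.residue_surjective (R := R)).hasRightInverse
  set q := Ideal.Quotient.mk J
  have hdvd : ∏ e ∈ s, (Polynomial.X - Polynomial.C (q (σ e))) ∣ F.map q := by
    refine Finset.prod_dvd_of_coprime (fun a ha b hb hab => ?_) fun e he => ?_
    · refine Polynomial.isCoprime_X_sub_C_of_isUnit_sub ?_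
      rw [← map_sub]
      refine RingHom.isUnit_map _ ?_
      by_contra hu
      have := (IsLocalRing.residue_eq_zero_iff _).2 ((IsLocalRing.mem_maximalIdeal _).2 hu)
      rw [map_sub, hσ, hσ, sub_eq_zero] at this
      exact hab this
    · rw [Polynomial.dvd_iff_isRoot, Polynomial.IsRoot, Polynomial.eval_map, Polynomial.eval₂_at_apply,
        Ideal.Quotient.eq_zero_iff_mem]
      exact h _ (by rw [hσ]; exact hs he)
  have hF : F.map q = 0 := by
    nontriviality (R ⧸ J)
    by_contra hne
    refine (Polynomial.monic_prod_of_monic _ _ fun e _ =>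
      Polynomial.monic_X_sub_C _).not_dvd_of_natDegree_lt hne ?_ hdvd
    rw [Polynomial.natDegree_prod_of_monic _ _ fun e _ => Polynomial.monic_X_sub_C _]
    simp only [Polynomial.natDegree_X_sub_C, Finset.sum_const, hcard, smul_eq_mul, mul_one]
    exact (Polynomial.natDegree_map_le).trans_lt (Nat.lt_succ_self _)
  have := congr_arg (fun G => Polynomial.coeff G i) hF
  simpa [q, Ideal.Quotient.eq_zero_iff_mem] using this

lemma finite_residues_of_mem {R : Type} [CommRing R] [IsLocalRing R] {P : Set (Ideal R)}
    (hP : P.Finite) (hp : ∀ p ∈ P, p.IsPrime) (b h : R) (hs : Set R)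
    (hinv : ∀ p ∈ P, b ∈ p → h ∈ p → ¬ hs ⊆ p) :
    (IsLocalRing.residue R '' {y | ∃ p ∈ P, b + y * h ∈ p ∧ hs ⊆ p}).Finite := by
  have : IsLocalRing.residue R '' {y | ∃ p ∈ P, b + y * h ∈ p ∧ hs ⊆ p} ⊆
      ⋃ p ∈ P, IsLocalRing.residue R '' {y | b + y * h ∈ p ∧ hs ⊆ p} := by
    rintro _ ⟨y, ⟨p, hpP, hy⟩, rfl⟩
    exact Set.mem_biUnion hpP ⟨y, hy, rfl⟩
  refine (hP.biUnion fun p hpP => Set.Subsingleton.finite ?_).subset this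
  rintro _ ⟨y, ⟨hy, hsp⟩, rfl⟩ _ ⟨y', ⟨hy', -⟩, rfl⟩
  have := hp p hpP
  by_contra hne
  have hu : IsUnit (y - y') := by
    by_contra hu
    apply hne
    rw [← sub_eq_zero, ← map_sub]
    exact (IsLocalRing.residue_eq_zero_iff _).2 ((IsLocalRing.mem_maximalIdeal _).2 hu)
  have hh : h ∈ p := (Ideal.unit_mul_mem_iff_mem p hu).1 (by
    have := p.sub_mem hy hy'
    rwa [add_sub_add_left_eq_sub, ← sub_mul] at this)
  exact hinv p hpP ((p.add_mem_iff_left (p.mul_mem_left y hh)).1 hy) hh hsp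

lemma exists_zipWith_of_mem_ofList {T : Type} [CommRing T] {l : List T} {t : T}
    (h : t ∈ Ideal.ofList l) :
    ∃ ts : List T, ts.length = l.length ∧ t = (List.zipWith (· * ·) ts l).sum := by
  induction l generalizing t with
  | nil => exact ⟨[], rfl, by simpa using h⟩
  | cons a l ih =>
    rw [Ideal.ofList_cons] at h
    obtain ⟨y, hy, z, hz, rfl⟩ := Submodule.mem_sup.1 h
    obtain ⟨r, rfl⟩ := Ideal.mem_span_singleton'.1 hy
    obtain ⟨ts, hl, rfl⟩ := ih hz
    exact ⟨r :: ts, by simp [hl], by simp⟩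

/-- The ideals obtained from `I` by successive links along regular sequences of length `g`. -/
inductive Reach {B : Type} [CommRing B] (g : ℕ) (I : Ideal B) : Ideal B → Prop
  | base : Reach g I I
  | step (K : Ideal B) (α : List B) : Reach g I K → α.length = g → (∀ x ∈ α, x ∈ K) →
      IsRegular B α → Reach g I ((Ideal.ofList α).colon (K : Set B))

/-- A family of ideals of `R`, parametrized by `Z`, which specializes to an ideal of `T` along `φ`,
together with a sequence `β` of elements of the family. -/
structure IsFamily {R T : Type} [CommRing R] [CommRing T] [Algebra R T] (J : Ideal R)
    (g : ℕ) (Q : Ideal R → Prop) {S : Type} [CommRing S] (𝒦 : Ideal S) (φ : S →+* T)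
    (Z : Set (S →+* R)) (β : List S) : Prop where
  noeth : IsNoetherianRing S
  dense : ∀ f, (∀ z ∈ Z, z f ∈ J) → φ f ∈ J.map (algebraMap R T)
  lifts : LiftsAlong g 𝒦 φ
  mem : ∀ x ∈ β, x ∈ 𝒦
  lifts_of_mem : ∀ z ∈ Z, LiftsAlong g 𝒦 z
  prop : ∀ z ∈ Z, Q (𝒦.map z)
  reg : ∀ z ∈ Z, IsRegular R (β.map z)

/-- `K` and the sequence `γ` are a specialization of a family of ideals of `R`. -/
def InFamily {R T : Type} [CommRing R] [CommRing T] [Algebra R T] (J : Ideal R)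
    (g : ℕ) (Q : Ideal R → Prop) (K : Ideal T) (γ : List T) : Prop :=
  ∃ (S : Type) (_ : CommRing S) (𝒦 : Ideal S) (φ : S →+* T) (Z : Set (S →+* R)) (β : List S),
    IsFamily J g Q 𝒦 φ Z β ∧ 𝒦.map φ = K ∧ β.map φ = γ

section
variable {R T : Type} [CommRing R] [CommRing T] [Algebra R T] {J : Ideal R} {g : ℕ}
  {Q : Ideal R → Prop}

lemma InFamily.le {K : Ideal T} {γ : List T} (h : InFamily J g Q K γ) (hQ : ∀ L, Q L → L ≤ J) :
    K ≤ J.map (algebraMap R T) := by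
  obtain ⟨S, _, 𝒦, φ, Z, β, H, rfl, rfl⟩ := h
  rw [Ideal.map_le_iff_le_comap]
  exact fun f hf => H.dense f fun z hz => hQ _ (H.prop z hz) (Ideal.mem_map_of_mem _ hf)

lemma InFamily.of_flat [IsLocalRing R] [IsNoetherianRing R] [IsLocalRing T] [IsNoetherianRing T]
    [Module.Flat R T] {I : Ideal R} (hI : GPerf g I) {α : List R} (hl : α.length = g)
    (hα : ∀ x ∈ α, x ∈ I) (hr : IsRegular R α) (hQ : Q I) :
    InFamily J g Q (I.map (algebraMap R T)) [] := by
  refine ⟨R, inferInstance, I, algebraMap R T, {RingHom.id R}, [], ⟨inferInstance, fun f hf =>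
    Ideal.mem_map_of_mem _ (hf _ rfl), LiftsAlong.of_flat (RingHom.flat_algebraMap_iff.2 inferInstance)
    hI hl hα hr, by simp, ?_, ?_, ?_⟩, rfl, rfl⟩
  · rintro _ rfl
    exact LiftsAlong.of_flat (RingHom.Flat.id R) hI hl hα hr
  · rintro _ rfl
    rwa [Ideal.map_id]
  · rintro _ rfl
    exact isRegular_iff_wreg'.2 ⟨.nil _ _, by simp⟩

lemma InFamily.colon [IsLocalRing R] {K : Ideal T} {γ : List T} (h : InFamily J g Q K γ)
    (hl : γ.length = g) (hr : IsRegular T γ)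
    (hQ : ∀ L α, Q L → α.length = g → (∀ x ∈ α, x ∈ L) → IsRegular R α →
      Q ((Ideal.ofList α).colon (L : Set R))) :
    InFamily J g Q ((Ideal.ofList γ).colon (K : Set T)) [] := by
  obtain ⟨S, _, 𝒦, φ, Z, β, H, rfl, rfl⟩ := h
  rw [List.length_map] at hl
  have := H.noeth
  have hK : 𝒦.FG := IsNoetherian.noetherian 𝒦
  refine ⟨S, inferInstance, (Ideal.ofList β).colon (𝒦 : Set S), φ, Z, [], ⟨H.noeth, H.dense,
    (H.lifts.colon hK hl H.mem hr).1, by simp, fun z hz =>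
    ((H.lifts_of_mem z hz).colon hK hl H.mem (H.reg z hz)).1, fun z hz => ?_, fun z hz =>
    isRegular_iff_wreg'.2 ⟨.nil _ _, by simp⟩⟩, (H.lifts.colon hK hl H.mem hr).2, rfl⟩
  rw [((H.lifts_of_mem z hz).colon hK hl H.mem (H.reg z hz)).2]
  exact hQ _ _ (H.prop z hz) (by rw [List.length_map, hl]) (mem_ofList_map H.mem) (H.reg z hz)

variable [IsLocalRing R] [IsNoetherianRing R] [IsLocalRing T] [IsNoetherianRing T]

lemma IsFamily.polynomial [Infinite (IsLocalRing.ResidueField R)] {S : Type} [CommRing S]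
    {𝒦 : Ideal S} {φ : S →+* T} {Z : Set (S →+* R)} {β : List S}
    (H : IsFamily J g Q 𝒦 φ Z β) (t : T) (E : (S →+* R) → Set R)
    (hE : ∀ z ∈ Z, (IsLocalRing.residue R '' E z).Finite) :
    IsFamily J g Q (𝒦.map Polynomial.C) (Polynomial.eval₂RingHom φ t)
      {z : Polynomial S →+* R | z.comp Polynomial.C ∈ Z ∧ z Polynomial.X ∉ E (z.comp Polynomial.C)}
      (β.map Polynomial.C) := by
  have := H.noeth
  have hc : (Polynomial.eval₂RingHom φ t).comp Polynomial.C = φ := by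
    ext; simp
  refine ⟨inferInstance, fun F hF => ?_, LiftsAlong.polynomial (by rw [hc]; exact H.lifts),
    mem_ofList_map H.mem, fun z hz => LiftsAlong.polynomial (H.lifts_of_mem _ hz.1),
    fun z hz => ?_, fun z hz => ?_⟩
  · have hco : ∀ i, φ (F.coeff i) ∈ J.map (algebraMap R T) := fun i => by
      refine H.dense _ fun z hz => ?_
      have := coeff_mem_of_eval_mem (J := J) (F := F.map z) (hE z hz) (fun y hy => ?_) i
      · rwa [Polynomial.coeff_map] at this
      · have hcz : (Polynomial.eval₂RingHom z y).comp Polynomial.C = z := by ext; simp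
        rw [Polynomial.eval_map]
        refine hF (Polynomial.eval₂RingHom z y) ⟨by rwa [hcz], ?_⟩
        rw [hcz]
        intro h
        exact hy ⟨y, by simpa using h, rfl⟩
    rw [Polynomial.coe_eval₂RingHom, Polynomial.eval₂_eq_sum, Polynomial.sum]
    exact sum_mem fun i _ => Ideal.mul_mem_right _ _ (hco i)
  · rw [Ideal.map_map]
    exact H.prop _ hz.1
  · rw [List.map_map]
    exact H.reg _ hz.1

lemma IsFamily.inFamily_append [Infinite (IsLocalRing.ResidueField R)]
    (hQ : ∀ L, Q L → L ≤ IsLocalRing.maximalIdeal R) (ts : List T) :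
    ∀ {S : Type} [CommRing S] {𝒦 : Ideal S} {φ : S →+* T} {Z : Set (S →+* R)} {β : List S},
    IsFamily J g Q 𝒦 φ Z β → ∀ (hs : List S) (b : S), ts.length = hs.length → b ∈ 𝒦 →
    (∀ h ∈ hs, h ∈ 𝒦) → (∀ z ∈ Z, ∀ p ∈ associatedPrimes R (R ⧸ Ideal.ofList (β.map z)),
      z b ∈ p → ¬ ∀ h ∈ hs, z h ∈ p) →
    InFamily J g Q (𝒦.map φ)
      (β.map φ ++ [φ b + (List.zipWith (· * ·) ts (hs.map φ)).sum]) := by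
  induction ts with
  | nil =>
    intro S _ 𝒦 φ Z β H hs b hl hb hhs hinv
    obtain rfl : hs = [] := List.eq_nil_of_length_eq_zero hl.symm
    refine ⟨S, inferInstance, 𝒦, φ, Z, β ++ [b], ⟨H.noeth, H.dense, H.lifts, ?_, H.lifts_of_mem,
      H.prop, fun z hz => ?_⟩, rfl, by simp⟩
    · intro x hx
      rcases List.mem_append.1 hx with hx | hx
      · exact H.mem x hx
      · rwa [List.mem_singleton.1 hx]
    · have hr := isRegular_iff_wreg'.1 (H.reg z hz)
      rw [List.map_append, List.map_singleton]
      refine isRegular_iff_wreg'.2 ⟨wreg_snoc.2 ⟨hr.1, nzd_iff_associatedPrimes.2 fun p hp hbp =>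
        hinv z hz p hp hbp (by simp)⟩, fun x hx => ?_⟩
      rcases List.mem_append.1 hx with hx | hx
      · exact hr.2 x hx
      · rw [List.mem_singleton.1 hx]
        exact hQ _ (H.prop z hz) (Ideal.mem_map_of_mem _ hb)
  | cons t ts ih =>
    intro S _ 𝒦 φ Z β H hs b hl hb hhs hinv
    obtain ⟨h, hs, rfl⟩ : ∃ h hs', hs = h :: hs' := by
      cases hs with
      | nil => simp at hl
      | cons h hs => exact ⟨h, hs, rfl⟩
    have H' := H.polynomial t (fun z => {y | ∃ p ∈ associatedPrimes R (R ⧸ Ideal.ofList (β.map z)),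
      z b + y * z h ∈ p ∧ z '' {x | x ∈ hs} ⊆ p}) (fun z hz =>
      finite_residues_of_mem (associatedPrimes.finite R _) (fun p hp => hp.isPrime) _ _ _
        fun p hp hbp hhp hsp => hinv z hz p hp hbp (List.forall_mem_cons.2 ⟨hhp, fun x hx =>
          hsp ⟨x, hx, rfl⟩⟩))
    have hc : (Polynomial.eval₂RingHom φ t).comp Polynomial.C = φ := by ext; simp
    have := ih H' (hs.map Polynomial.C) (Polynomial.C b + Polynomial.X * Polynomial.C h)
      (by simpa using hl) (Ideal.add_mem _ (Ideal.mem_map_of_mem _ hb)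
        (Ideal.mul_mem_left _ _ (Ideal.mem_map_of_mem _ (hhs h (by simp)))))
      (mem_ofList_map fun x hx => hhs x (by simp [hx])) ?_
    · rw [Ideal.map_map, hc] at this
      convert this using 2
      · rw [List.map_map]; congr 1; ext x; simp
      · rw [List.map_map]
        have : List.map (⇑(Polynomial.eval₂RingHom φ t) ∘ ⇑(Polynomial.C : S →+* Polynomial S)) hs =
          hs.map φ := by congr 1; ext x; simp
        rw [this]
        simp [add_assoc, mul_comm t]
    · intro z hz p hp hbp hsp
      refine hz.2 ⟨p, ?_, by simpa [mul_comm (z Polynomial.X)] using hbp, ?_⟩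
      · rwa [List.map_map] at hp
      · rintro _ ⟨x, hx, rfl⟩
        exact hsp _ (List.mem_map_of_mem hx)

lemma InFamily.append [Infinite (IsLocalRing.ResidueField R)]
    (hQ : ∀ L, Q L → L ≤ IsLocalRing.maximalIdeal R ∧
      ∃ α, α.length = g ∧ (∀ x ∈ α, x ∈ L) ∧ IsRegular R α) {K : Ideal T} {γ : List T}
    (h : InFamily J g Q K γ) (hlt : γ.length < g) {t : T} (ht : t ∈ K) :
    InFamily J g Q K (γ ++ [t]) := by
  obtain ⟨S, _, 𝒦, φ, Z, β, H, rfl, rfl⟩ := h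
  have := H.noeth
  obtain ⟨s, hs⟩ : 𝒦.FG := IsNoetherian.noetherian 𝒦
  obtain rfl : Ideal.ofList s.toList = 𝒦 := by rw [← hs, Ideal.ofList]; simp
  have ht' := ht
  rw [← ofList_map] at ht'
  obtain ⟨ts, hl, hts⟩ := exists_zipWith_of_mem_ofList ht'
  have := H.inFamily_append (fun L hL => (hQ L hL).1) ts s.toList 0 (by simpa using hl)
    (zero_mem _) (ofList_le.1 le_rfl) fun z hz p hp _ hsp => by
      obtain ⟨hm, α, hα, hαK, hαr⟩ := hQ _ (H.prop z hz)
      obtain ⟨x, hx, hxn⟩ := exists_nzd_of_length_lt hm hαK (mem_ofList_map H.mem)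
        (isRegular_iff_wreg.1 hαr).1 (isRegular_iff_wreg.1 (H.reg z hz)).1
        (by rwa [hα, List.length_map, ← List.length_map (f := φ)])
      refine associatedPrimes_avoid hx hxn p hp ?_
      rw [Ideal.map_le_iff_le_comap, ofList_le]
      exact hsp
  rwa [map_zero, zero_add, ← hts] at this

lemma InFamily.append_list [Infinite (IsLocalRing.ResidueField R)]
    (hQ : ∀ L, Q L → L ≤ IsLocalRing.maximalIdeal R ∧
      ∃ α, α.length = g ∧ (∀ x ∈ α, x ∈ L) ∧ IsRegular R α) {K : Ideal T}
    (h : InFamily J g Q K []) (γ : List T) (hl : γ.length ≤ g) (hγ : ∀ x ∈ γ, x ∈ K) :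
    InFamily J g Q K γ := by
  induction γ using List.reverseRecOn with
  | nil => exact h
  | append_singleton γ t ih =>
    rw [List.length_append, List.length_singleton] at hl
    exact (ih (by omega) fun x hx => hγ x (by simp [hx])).append hQ (by omega) (hγ t (by simp))

/-- Ideals of `T` reached from `I T` lie in the extension of any ideal containing all the ideals
reached from `I`. -/
lemma Reach.le_map [Infinite (IsLocalRing.ResidueField R)] [Module.Flat R T] {I : Ideal R}
    (hI : GPerf g I) {α : List R} (hl : α.length = g) (hα : ∀ x ∈ α, x ∈ I) (hr : IsRegular R α)
    (hm : ∀ L, Reach g I L → L ≤ IsLocalRing.maximalIdeal R) (hJ : ∀ L, Reach g I L → L ≤ J)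
    {K : Ideal T} (hK : Reach g (I.map (algebraMap R T)) K) : K ≤ J.map (algebraMap R T) := by
  have hQ : ∀ L, Reach g I L → L ≤ IsLocalRing.maximalIdeal R ∧
      ∃ α, α.length = g ∧ (∀ x ∈ α, x ∈ L) ∧ IsRegular R α := fun L hL => by
    refine ⟨hm L hL, ?_⟩
    cases hL with
    | base => exact ⟨α, hl, hα, hr⟩
    | step K β hK hβ hβK hβr => exact ⟨β, hβ, ofList_le.1 (le_colon_self _ _), hβr⟩
  refine InFamily.le (Q := Reach g I) (g := g) (γ := []) ?_ hJ
  induction hK with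
  | base => exact InFamily.of_flat hI hl hα hr .base
  | step K γ _ hγ hγK hγr ih =>
    exact (ih.append_list hQ γ hγ.le hγK).colon hγ hγr fun L α hL hα hαL hαr =>
      Reach.step L α hL hα hαL hαr
end

section
variable {B : Type} [CommRing B] [IsLocalRing B] [IsNoetherianRing B] {g : ℕ} {I K : Ideal B}

lemma Reach.gperf (hI : GPerf g I) (h : Reach g I K) : GPerf g K := by
  induction h with
  | base => exact hI
  | step K α _ hl hα hr ih => exact ih.colon hl hα hr

omit [IsLocalRing B] [IsNoetherianRing B] in
lemma Reach.exists_isRegular (hI : ∃ α : List B, α.length = g ∧ (∀ x ∈ α, x ∈ I) ∧ IsRegular B α)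
    (h : Reach g I K) : ∃ α : List B, α.length = g ∧ (∀ x ∈ α, x ∈ K) ∧ IsRegular B α := by
  cases h with
  | base => exact hI
  | step K β _ hβ _ hβr => exact ⟨β, hβ, ofList_le.1 (le_colon_self _ _), hβr⟩

omit [IsLocalRing B] [IsNoetherianRing B] in
lemma isCompleteIntersectionIdeal_ofList {α : List B} (h : IsRegular B α) :
    IsCompleteIntersectionIdeal B (Ideal.ofList α) :=
  ⟨(isRegular_iff_wreg.1 h).2, α, h, rfl⟩

lemma Reach.inSameLinkageClass (hI : GPerf g I)
    (hI1 : I ≠ ⊤) (hnl : ¬ Licci B I) (h : Reach g I K) : K ≠ ⊤ ∧ InSameLinkageClass B I K := by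
  induction h with
  | base => exact ⟨hI1, .refl _⟩
  | step K α hK hl hα hr ih =>
    have hci := isCompleteIntersectionIdeal_ofList hr
    have h2 := (hK.gperf hI).colon_colon hl hα hr
    have hne : (Ideal.ofList α).colon (K : Set B) ≠ ⊤ := fun htop => by
      rw [htop, Submodule.top_coe, Submodule.colon_univ] at h2
      exact hnl ⟨K, ih.2, h2 ▸ hci⟩
    exact ⟨hne, ih.2.trans _ _ _ (.rel _ _ ⟨ih.1, hne, _, hci,
      le_inf (ofList_le.2 hα) (le_colon_self _ _), h2, rfl⟩)⟩

omit [IsLocalRing B] [IsNoetherianRing B] in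
lemma IsDirectlyLinked.symm {K L : Ideal B} (h : IsDirectlyLinked B K L) :
    IsDirectlyLinked B L K := by
  obtain ⟨h1, h2, c, hc, hle, h3, h4⟩ := h
  exact ⟨h2, h1, c, hc, by rwa [inf_comm], h4, h3⟩

omit [IsLocalRing B] [IsNoetherianRing B] in
/-- A property which is stable under direct linkage is stable under linkage. -/
lemma InSameLinkageClass.induction {P : Ideal B → Prop}
    (hP : ∀ K L, IsDirectlyLinked B K L → P K → P L) {K L : Ideal B}
    (h : InSameLinkageClass B K L) : P K ↔ P L := by
  induction h with
  | rel K L h => exact ⟨hP _ _ h, hP _ _ h.symm⟩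
  | refl => rfl
  | symm _ _ _ ih => exact ih.symm
  | trans _ _ _ _ _ h1 h2 => exact h1.trans h2

lemma Reach.length_eq (hI : GPerf g I)
    (hα : ∃ α : List B, α.length = g ∧ (∀ x ∈ α, x ∈ I) ∧ IsRegular B α)
    (h : Reach g I K) (hK : K ≠ ⊤) {c : List B} (hc : ∀ x ∈ c, x ∈ K)
    (hrc : IsRegular B c) (hne : (Ideal.ofList c).colon (K : Set B) ≠ Ideal.ofList c) :
    c.length = g := by
  obtain ⟨β, hl, hβ, hr⟩ := h.exists_isRegular hα
  exact (h.gperf hI).length_eq hK hl hβ hr hc hrc hne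

lemma Reach.of_inSameLinkageClass (hI : GPerf g I)
    (hα : ∃ α : List B, α.length = g ∧ (∀ x ∈ α, x ∈ I) ∧ IsRegular B α)
    (h : InSameLinkageClass B I K) : Reach g I K := by
  refine (h.induction (P := Reach g I) fun K L hKL hK => ?_).1 .base
  obtain ⟨h1, h2, _, ⟨hc, rs, hrs, rfl⟩, hle, h3, rfl⟩ := hKL
  have hrsK := ofList_le.1 (hle.trans inf_le_left)
  refine hK.step K rs (hK.length_eq hI hα h1 hrsK hrs fun h => ?_) hrsK hrs
  rw [h] at h3
  exact h1 (h3.symm.trans ((Submodule.colon_eq_top_iff_subset _).2 le_rfl))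

end

section
variable {R T : Type} [CommRing R] [CommRing T] [IsLocalRing R] [IsNoetherianRing R]
  [IsLocalRing T] [IsNoetherianRing T] [Algebra R T] [Module.Flat R T] {I : Ideal R}

omit [IsLocalRing R] [IsLocalRing T] [IsNoetherianRing T] in
lemma InSameLinkageClass.map_of_flat (hIT : I.map (algebraMap R T) ≠ ⊤)
    (hnl : ¬ Licci T (I.map (algebraMap R T))) {K : Ideal R} (h : InSameLinkageClass R I K) :
    K.map (algebraMap R T) ≠ ⊤ ∧
      InSameLinkageClass T (I.map (algebraMap R T)) (K.map (algebraMap R T)) := by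
  refine (h.induction (P := fun K => K.map (algebraMap R T) ≠ ⊤ ∧
      InSameLinkageClass T (I.map (algebraMap R T)) (K.map (algebraMap R T)))
      fun K L hKL hK => ?_).1 ⟨hIT, .refl _⟩
  obtain ⟨h1, h2, _, ⟨hc, rs, hrs, rfl⟩, hle, h3, h4⟩ := hKL
  have hcK := Ideal.map_mono (f := algebraMap R T) (hle.trans inf_le_left)
  have hcL := Ideal.map_mono (f := algebraMap R T) (hle.trans inf_le_right)
  have hcT : (Ideal.ofList rs).map (algebraMap R T) ≠ ⊤ := fun h =>
    hK.1 (top_unique (h.symm.le.trans hcK))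
  have hci := isCompleteIntersectionIdeal_ofList (isRegular_map_of_flat hrs hcT)
  rw [ofList_map] at hci
  have h3' := map_colon_of_flat (A' := T) (Ideal.ofList rs) L (IsNoetherian.noetherian L)
  have h4' := map_colon_of_flat (A' := T) (Ideal.ofList rs) K (IsNoetherian.noetherian K)
  rw [h3] at h3'
  rw [h4] at h4'
  have hLT : L.map (algebraMap R T) ≠ ⊤ := fun htop => by
    rw [htop, Submodule.top_coe, Submodule.colon_univ] at h3'
    exact hnl ⟨_, hK.2, h3' ▸ hci⟩
  exact ⟨hLT, hK.2.trans _ _ _ (.rel _ _ ⟨hK.1, hLT, _, hci, le_inf hcK hcL, h3'.symm, h4'.symm⟩)⟩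

omit [IsLocalRing R] [IsLocalRing T] [IsNoetherianRing T] in
lemma Licci.map_of_flat (hIT : I.map (algebraMap R T) ≠ ⊤) (h : Licci R I) :
    Licci T (I.map (algebraMap R T)) := by
  by_contra hnl
  obtain ⟨_, hJ, hJ1, rs, hrs, rfl⟩ := h
  obtain ⟨h1, h2⟩ := hJ.map_of_flat hIT hnl
  refine hnl ⟨_, h2, ?_⟩
  have := isCompleteIntersectionIdeal_ofList (isRegular_map_of_flat hrs h1)
  rwa [ofList_map] at this

omit [IsLocalRing R] [IsLocalRing T] [IsNoetherianRing T] in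
lemma map_intLink_le (hIT : I.map (algebraMap R T) ≠ ⊤) :
    (intLink R I).map (algebraMap R T) ≤ intLink T (I.map (algebraMap R T)) := by
  by_cases hT : Licci T (I.map (algebraMap R T))
  · rw [intLink, intLink, if_pos hT]
    exact le_top
  · have hR : ¬ Licci R I := fun h => hT (h.map_of_flat hIT)
    rw [intLink, intLink, if_neg hT, if_neg hR, Ideal.map_le_iff_le_comap]
    refine sSup_le fun K hK => ?_
    rw [← Ideal.map_le_iff_le_comap]
    exact le_sSup (InSameLinkageClass.map_of_flat hIT hT hK).2

lemma intLink_map_of_flat [Infinite (IsLocalRing.ResidueField R)] {g : ℕ} (hI : GPerf g I)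
    {α : List R} (hl : α.length = g) (hα : ∀ x ∈ α, x ∈ I) (hr : IsRegular R α)
    (hIT : I.map (algebraMap R T) ≠ ⊤) :
    intLink T (I.map (algebraMap R T)) = (intLink R I).map (algebraMap R T) := by
  refine le_antisymm ?_ (map_intLink_le hIT)
  by_cases hR : Licci R I
  · have : intLink R I = ⊤ := by rw [intLink, if_pos hR]
    rw [this, Ideal.map_top]
    exact le_top
  have hI1 : I ≠ ⊤ := fun h => hIT (by rw [h, Ideal.map_top])
  have hRm : ∀ L, Reach g I L → L ≤ IsLocalRing.maximalIdeal R := fun L hL =>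
    IsLocalRing.le_maximalIdeal (hL.inSameLinkageClass hI hI1 hR).1
  have hRJ : ∀ L, Reach g I L → L ≤ intLink R I := fun L hL => by
    rw [intLink, if_neg hR]
    exact le_sSup (hL.inSameLinkageClass hI hI1 hR).2
  have hle : ∀ K, Reach g (I.map (algebraMap R T)) K → K ≤ (intLink R I).map (algebraMap R T) :=
    fun K hK => hK.le_map hI hl hα hr hRm hRJ
  have hIT' := hI.map_of_flat (T := T) hl hα hr
  have hαT : ∃ β : List T, β.length = g ∧ (∀ x ∈ β, x ∈ I.map (algebraMap R T)) ∧ IsRegular T β :=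
    ⟨α.map (algebraMap R T), by rw [List.length_map, hl], mem_ofList_map hα,
      isRegular_map_of_flat hr fun h => hIT (top_unique (h.symm.le.trans
        (Ideal.map_mono (ofList_le.2 hα))))⟩
  by_cases hT : Licci T (I.map (algebraMap R T))
  · obtain ⟨_, hJ, hJ1, rs, hrs, rfl⟩ := hT
    have hreach := Reach.of_inSameLinkageClass hIT' hαT hJ
    have htop : (Ideal.ofList rs).colon (Ideal.ofList rs : Set T) = ⊤ :=
      (Submodule.colon_eq_top_iff_subset _).2 le_rfl
    have hrs' := ofList_le.1 (le_refl (Ideal.ofList rs))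
    have h1 := hle _ (hreach.step _ rs (hreach.length_eq hIT' hαT hJ1 hrs' hrs
      (by rw [htop]; exact hJ1.symm)) hrs' hrs)
    rw [htop] at h1
    exact le_top.trans h1
  · rw [intLink, if_neg hT]
    exact sSup_le fun K hK => hle K (Reach.of_inSameLinkageClass hIT' hαT hK)
end

section
variable {A : Type} [CommRing A] [IsLocalRing A]

lemma length_dual_simple_le (h : SimpleSocle (IsLocalRing.maximalIdeal A) ⊥) (S : Type)
    [AddCommGroup S] [Module A S] [IsSimpleModule A S] : Module.length A (S →ₗ[A] A) ≤ 1 := by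
  obtain ⟨u, _, hu, hu'⟩ := h
  obtain ⟨m, hm, ⟨e⟩⟩ := isSimpleModule_iff_quot_maximal.1 ‹IsSimpleModule A S›
  obtain rfl := IsLocalRing.eq_maximalIdeal hm
  let q : (A ⧸ IsLocalRing.maximalIdeal A) →ₗ[A] Submodule.span A {u} :=
    Submodule.liftQ _ (LinearMap.toSpanSingleton A _ ⟨u, Submodule.mem_span_singleton_self u⟩)
      fun v hv => by
        ext
        simpa [mul_comm] using hu v hv
  have hq : Function.Surjective q := by
    rintro ⟨x, hx⟩
    obtain ⟨r, rfl⟩ := Submodule.mem_span_singleton.1 hx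
    exact ⟨Submodule.Quotient.mk r, rfl⟩
  have : IsSimpleModule A (A ⧸ IsLocalRing.maximalIdeal A) := IsSimpleModule.congr e.symm
  have h1 := Module.length_le_of_surjective q hq
  rw [Module.length_eq_one A (A ⧸ IsLocalRing.maximalIdeal A)] at h1
  let s := e.symm (Submodule.Quotient.mk 1)
  have hs : ∀ t : S, ∃ r : A, t = r • s := fun t => by
    obtain ⟨r, hr⟩ := Submodule.Quotient.mk_surjective _ (e t)
    refine ⟨r, e.injective ?_⟩
    rw [map_smul, e.apply_symm_apply, ← hr, ← Submodule.Quotient.mk_smul, smul_eq_mul, mul_one]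
  have hms : ∀ v ∈ IsLocalRing.maximalIdeal A, v • s = 0 := fun v hv => by
    rw [← map_smul, ← Submodule.Quotient.mk_smul, smul_eq_mul, mul_one,
      (Submodule.Quotient.mk_eq_zero _).2 hv, map_zero]
  let ev : (S →ₗ[A] A) →ₗ[A] Submodule.span A {u} :=
    LinearMap.codRestrict _ (LinearMap.applyₗ s) fun f => by
      obtain ⟨r, hr⟩ := hu' (f s) fun v hv => by
        have := congr_arg f (hms v hv)
        rw [map_smul, map_zero, smul_eq_mul, mul_comm] at this
        exact this
      rw [Ideal.mem_bot, sub_eq_zero] at hr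
      exact Submodule.mem_span_singleton.2 ⟨r, by rw [LinearMap.applyₗ_apply_apply, hr, smul_eq_mul, mul_comm]⟩
  refine (Module.length_le_of_injective ev fun f g hfg => ?_).trans h1
  have hfg : f s = g s := congr_arg Subtype.val hfg
  ext t
  obtain ⟨r, rfl⟩ := hs t
  rw [map_smul, map_smul, hfg]

lemma length_dual_le (h : SimpleSocle (IsLocalRing.maximalIdeal A) ⊥) {M : Type}
    [AddCommGroup M] [Module A M] (hM : IsFiniteLength A M) :
    Module.length A (M →ₗ[A] A) ≤ Module.length A M := by
  induction hM with
  | of_subsingleton => rw [Module.length_eq_zero]; exact zero_le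
  | @of_simple_quotient M _ _ N _ _ ih =>
    have h1 := Module.length_eq_add_of_exact N.subtype N.mkQ N.injective_subtype N.mkQ_surjective
      (LinearMap.exact_subtype_mkQ N)
    rw [h1, Module.length_eq_one A (M ⧸ N)]
    let f := LinearMap.lcomp A A N.mkQ
    let g := LinearMap.lcomp A A N.subtype
    have hf : Function.Injective f := fun a b hab => by
      ext x
      exact LinearMap.congr_fun hab x
    have hex : Function.Exact f g.rangeRestrict := fun φ => by
      constructor
      · intro hφ
        have hφ : φ ∘ₗ N.subtype = 0 := congr_arg Subtype.val hφ
        exact ⟨N.liftQ φ fun x hx => LinearMap.congr_fun hφ ⟨x, hx⟩, by ext; rfl⟩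
      · rintro ⟨ψ, rfl⟩
        ext x
        have : N.mkQ x = 0 := by simp
        change ψ (N.mkQ x) = 0
        rw [this, map_zero]
    have h2 := Module.length_eq_add_of_exact (P := LinearMap.range g) f g.rangeRestrict hf
      g.surjective_rangeRestrict hex
    rw [h2, add_comm]
    exact add_le_add ((Module.length_le_of_injective _ (Submodule.injective_subtype _)).trans ih)
      (length_dual_simple_le h _)

variable [IsArtinianRing A]

/-- Over a self-dual artinian ring, homomorphisms from ideals to the ring are multiplications, and
ideals are double annihilators. -/
lemma exists_mul_and_perp_perp (h : SimpleSocle (IsLocalRing.maximalIdeal A) ⊥) (K : Ideal A) :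
    (∀ φ : K →ₗ[A] A, ∃ a, ∀ x : K, φ x = a * x) ∧
    (⊥ : Ideal A).colon ((⊥ : Ideal A).colon (K : Set A) : Set A) = K := by
  have key : ∀ K : Ideal A, (∀ φ : K →ₗ[A] A, ∃ a, ∀ x : K, φ x = a * x) ∧
      Module.length A ((⊥ : Ideal A).colon (K : Set A)) = Module.length A (A ⧸ K) := fun K => by
    have hfin : ∀ (M : Type) [AddCommGroup M] [Module A M] [Module.Finite A M],
        IsFiniteLength A M := fun M _ _ _ =>
      isFiniteLength_iff_isNoetherian_isArtinian.2 ⟨inferInstance, inferInstance⟩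
    have hA := Module.length_eq_add_of_exact K.subtype K.mkQ K.injective_subtype K.mkQ_surjective
      (LinearMap.exact_subtype_mkQ K)
    let P := (⊥ : Ideal A).colon (K : Set A)
    let ρ : A →ₗ[A] (K →ₗ[A] A) := LinearMap.toSpanSingleton A _ K.subtype
    have hρ : LinearMap.ker ρ = P := by
      ext a
      rw [LinearMap.mem_ker, mem_colon_ideal, LinearMap.ext_iff]
      exact ⟨fun H s hs => H ⟨s, hs⟩, fun H s => H s s.2⟩
    have hex : Function.Exact P.subtype ρ.rangeRestrict := by
      rw [LinearMap.exact_iff, LinearMap.ker_rangeRestrict, hρ, Submodule.range_subtype]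
    have hA' := Module.length_eq_add_of_exact (P := LinearMap.range ρ) P.subtype ρ.rangeRestrict P.injective_subtype
      ρ.surjective_rangeRestrict hex
    let σ : P →ₗ[A] ((A ⧸ K) →ₗ[A] A) :=
      { toFun := fun p => K.liftQ (LinearMap.toSpanSingleton A A p) fun x hx => by
          rw [LinearMap.mem_ker, LinearMap.toSpanSingleton_apply, smul_eq_mul, mul_comm]
          exact mem_colon_ideal.1 p.2 x hx
        map_add' := fun p q => Submodule.linearMap_qext _ (LinearMap.ext fun x =>
          mul_add x (p : A) q)
        map_smul' := fun r p => Submodule.linearMap_qext _ (LinearMap.ext fun x =>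
          mul_left_comm x r (p : A)) }
    have hσ : Function.Injective σ := fun p q hpq => by
      have : (1 : A) * p = 1 * q := LinearMap.congr_fun hpq (Submodule.Quotient.mk 1)
      rwa [one_mul, one_mul, Subtype.coe_inj] at this
    have h1 := (Module.length_le_of_injective σ hσ).trans (length_dual_le h (hfin (A ⧸ K)))
    have h2 := length_dual_le h (hfin K)
    have h3 := Module.length_le_of_injective (N := LinearMap.range ρ) (LinearMap.range ρ).subtype (LinearMap.range ρ).injective_subtype
    have hKt : Module.length A K ≠ ⊤ := Module.length_ne_top_iff.2 (hfin K)
    have hQt : Module.length A (A ⧸ K) ≠ ⊤ := Module.length_ne_top_iff.2 (hfin _)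
    have hHt : Module.length A (K →ₗ[A] A) ≠ ⊤ := ne_top_of_le_ne_top hKt h2
    have h4 : Module.length A (LinearMap.range ρ) ≠ ⊤ := ne_top_of_le_ne_top hHt h3
    have h5 : Module.length A P ≠ ⊤ := ne_top_of_le_ne_top hQt h1
    rw [hA] at hA'
    change _ ∧ Module.length A P = _
    have hlen : Module.length A P = Module.length A (A ⧸ K) ∧
        Module.length A (K →ₗ[A] A) ≤ Module.length A (LinearMap.range ρ) := by
      generalize Module.length A P = a at *
      generalize Module.length A (A ⧸ K) = b at *
      generalize Module.length A (K →ₗ[A] A) = c at *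
      generalize Module.length A K = d at *
      generalize Module.length A (LinearMap.range ρ) = e at *
      lift a to ℕ using h5
      lift b to ℕ using hQt
      lift c to ℕ using hHt
      lift d to ℕ using hKt
      lift e to ℕ using h4
      norm_cast at *
      omega
    refine ⟨?_, hlen.1⟩
    have : LinearMap.range ρ = ⊤ := by
      by_contra hne
      obtain ⟨i1, i2⟩ := isFiniteLength_iff_isNoetherian_isArtinian.1
        (Module.length_ne_top_iff.1 hHt)
      exact (Submodule.length_lt hne).not_ge hlen.2
    intro φ
    obtain ⟨a, rfl⟩ := LinearMap.range_eq_top.1 this φ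
    exact ⟨a, fun x => rfl⟩
  refine ⟨(key K).1, ?_⟩
  let P := (⊥ : Ideal A).colon (K : Set A)
  have hle : K ≤ (⊥ : Ideal A).colon (P : Set A) := fun x hx => mem_colon_ideal.2 fun s hs => by
    rw [mul_comm]
    exact mem_colon_ideal.1 hs x hx
  by_contra hne
  have hlt := Submodule.height_strictMono (lt_of_le_of_ne hle (Ne.symm hne))
  rw [← Module.length_submodule, ← Module.length_submodule, (key P).2] at hlt
  have hA : ∀ K : Ideal A, Module.length A A = Module.length A K + Module.length A (A ⧸ K) :=
    fun K => Module.length_eq_add_of_exact K.subtype K.mkQ K.injective_subtype K.mkQ_surjective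
      (LinearMap.exact_subtype_mkQ K)
  have h1 := (hA P).symm.trans (hA K)
  rw [(key K).2, add_comm] at h1
  have := WithTop.add_right_cancel (Module.length_ne_top (R := A) (M := A ⧸ K)) h1
  exact hlt.ne this.symm

lemma gRefl_of_simpleSocle (h : SimpleSocle (IsLocalRing.maximalIdeal A) ⊥) (K : Ideal A) :
    GRefl A K := by
  have hB : Module.Baer A A := fun I g => by
    obtain ⟨a, ha⟩ := (exists_mul_and_perp_perp h I).1 g
    exact ⟨LinearMap.toSpanSingleton A A a, fun x hx => by simp [ha, mul_comm]⟩
  have hinj := hB.injective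
  have hext : ∀ (n : ℕ) (M : Type) [AddCommGroup M] [Module A M], ExtVanish n A M A := by
    intro n
    induction n with
    | zero => intro M _ _; exact extVanish_zero
    | succ n ih =>
      intro M _ _
      let p : (M →₀ A) →ₗ[A] M := Finsupp.linearCombination A id
      have hp : Function.Surjective p := Finsupp.linearCombination_surjective A Function.surjective_id
      refine (extVanish_succ_iff (N := LinearMap.ker p) (LinearMap.ker p).subtype p (Submodule.injective_subtype _)
        (LinearMap.exact_subtype_ker_map p) hp (fun n => ExtVanish.of_projective n) n).2
        ⟨fun φ => ?_, ih _⟩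
      obtain ⟨ψ, hψ⟩ := hinj.out (X := LinearMap.ker p) (LinearMap.ker p).subtype
        (Submodule.injective_subtype (LinearMap.ker p)) φ
      exact ⟨ψ, LinearMap.ext hψ⟩
  exact ⟨fun n => hext n _, fun n => hext n _, (exists_mul_and_perp_perp h K).2⟩

end

section
variable {B T : Type} [CommRing B] [CommRing T]

lemma mem_map_iff_of_ker {f : B →+* T} (hf : Function.Surjective f) {c : Ideal B} {u : B} :
    f u ∈ c.map f ↔ u ∈ c ⊔ RingHom.ker f := by
  rw [← Ideal.mem_comap, Ideal.comap_map_of_surjective _ hf, RingHom.ker_eq_comap_bot]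

lemma NZD_map_iff_of_ker {f : B →+* T} (hf : Function.Surjective f) {c : Ideal B} {a : B} :
    NZD (c.map f) (f a) ↔ NZD (c ⊔ RingHom.ker f) a := by
  constructor
  · intro H u hu
    rw [← mem_map_iff_of_ker hf] at hu ⊢
    exact H _ (by rwa [← map_mul])
  · intro H u hu
    obtain ⟨u, rfl⟩ := hf u
    rw [← map_mul] at hu
    rw [mem_map_iff_of_ker hf] at hu ⊢
    exact H u hu

lemma wreg_append_iff {f : B →+* T} (hf : Function.Surjective f) {α : List B}
    (hα : IsWeaklyRegular B α) (hk : RingHom.ker f = Ideal.ofList α) {β : List B} :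
    IsWeaklyRegular B (α ++ β) ↔ IsWeaklyRegular T (β.map f) := by
  induction β using List.reverseRecOn with
  | nil => simpa using hα
  | append_singleton β a ih =>
    rw [← List.append_assoc, wreg_snoc, ih, List.map_append, List.map_singleton, wreg_snoc,
      ofList_map, NZD_map_iff_of_ker hf, Ideal.ofList_append, hk, sup_comm]

lemma SimpleSocle.map {f : B →+* T} (hf : Function.Surjective f) {m c : Ideal B}
    (h : SimpleSocle m (c ⊔ RingHom.ker f)) : SimpleSocle (m.map f) (c.map f) := by
  obtain ⟨u, hu, hum, hu'⟩ := h
  refine ⟨f u, by rwa [mem_map_iff_of_ker hf], fun v hv => ?_, fun w hw => ?_⟩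
  · obtain ⟨v', hv', rfl⟩ := (Ideal.mem_map_iff_of_surjective f hf).1 hv
    rw [← map_mul, mem_map_iff_of_ker hf]
    exact hum v' hv'
  · obtain ⟨w, rfl⟩ := hf w
    obtain ⟨r, hr⟩ := hu' w fun v hv => by
      rw [← mem_map_iff_of_ker hf, map_mul]
      exact hw _ (Ideal.mem_map_of_mem f hv)
    exact ⟨f r, by rwa [← map_mul, ← map_sub, mem_map_iff_of_ker hf]⟩

lemma maximalIdeal_map_of_surjective [IsLocalRing B] [IsLocalRing T] {f : B →+* T}
    (hf : Function.Surjective f) :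
    (IsLocalRing.maximalIdeal B).map f = IsLocalRing.maximalIdeal T := by
  refine le_antisymm ?_ fun t ht => ?_
  · have : (IsLocalRing.maximalIdeal T).comap f = IsLocalRing.maximalIdeal B :=
      IsLocalRing.eq_maximalIdeal (Ideal.comap_isMaximal_of_surjective f hf)
    rw [← this]
    exact Ideal.map_comap_le
  · obtain ⟨b, rfl⟩ := hf t
    exact Ideal.mem_map_of_mem f fun hb => ht (hb.map f)

lemma withBot_le_sub {d : WithBot ℕ∞} {g n : ℕ} (h : d + g ≤ n) : d ≤ (n - g : ℕ) := by
  induction d with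
  | bot => exact bot_le
  | coe d =>
    have h' : d + (g : ℕ∞) ≤ (n : ℕ∞) := WithBot.coe_le_coe.1 h
    refine (WithBot.coe_le_coe (b := ((n - g : ℕ) : ℕ∞))).2 ?_
    rw [ENat.natCast_sub]
    exact ENat.le_sub_of_add_le_right (ENat.natCast_ne_top g) h'

variable [IsLocalRing B] [IsNoetherianRing B]

/-- A regular sequence extends to one as long as any other one. -/
lemma exists_wreg_append {τ β : List B} (hτ : ∀ x ∈ τ, x ∈ IsLocalRing.maximalIdeal B)
    (hβ : ∀ x ∈ β, x ∈ IsLocalRing.maximalIdeal B) (hrτ : IsWeaklyRegular B τ)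
    (hrβ : IsWeaklyRegular B β) (hle : β.length ≤ τ.length) :
    ∃ ρ : List B, (∀ x ∈ ρ, x ∈ IsLocalRing.maximalIdeal B) ∧ IsWeaklyRegular B (β ++ ρ) ∧
      β.length + ρ.length = τ.length := by
  obtain ⟨n, hn⟩ := Nat.exists_eq_add_of_le hle
  induction n generalizing β with
  | zero => exact ⟨[], by simp, by simpa using hrβ, by simpa using hn.symm⟩
  | succ n ih =>
    obtain ⟨z, hz, hzβ⟩ := exists_nzd_of_length_lt le_rfl hτ hβ hrτ hrβ (by omega)
    obtain ⟨ρ, h1, h2, h3⟩ := ih (β := β ++ [z])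
      (by simpa [or_imp, forall_and] using ⟨hβ, hz⟩) (wreg_snoc.2 ⟨hrβ, hzβ⟩)
      (by simp; omega) (by simp; omega)
    exact ⟨z :: ρ, List.forall_mem_cons.2 ⟨hz, h1⟩, by simpa using h2, by simp at h3 ⊢; omega⟩

end

/-- A ring of dimension at most `n` with a regular sequence of length `n` generating an ideal
with simple socle. -/
def GorLike (A : Type) [CommRing A] [IsLocalRing A] (n : ℕ) : Prop :=
  ringKrullDim A ≤ n ∧ ∃ rs : List A, rs.length = n ∧ (∀ x ∈ rs, x ∈ IsLocalRing.maximalIdeal A) ∧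
    IsWeaklyRegular A rs ∧ SimpleSocle (IsLocalRing.maximalIdeal A) (Ideal.ofList rs)

section
variable {A T : Type} [CommRing A] [CommRing T] [IsLocalRing A] [IsNoetherianRing A] [IsLocalRing T]

lemma GorLike.of_surjective {n : ℕ} (h : GorLike A n) {f : A →+* T} (hf : Function.Surjective f)
    {α : List A} (hα : IsWeaklyRegular A α) (hk : RingHom.ker f = Ideal.ofList α) :
    α.length ≤ n ∧ GorLike T (n - α.length) := by
  have hαm : ∀ x ∈ α, x ∈ IsLocalRing.maximalIdeal A :=
    ofList_le.1 (hk.ge.trans (IsLocalRing.le_maximalIdeal (RingHom.ker_ne_top f)))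
  obtain ⟨hd, rs, hl, hm, hr, hs⟩ := h
  have hdim := ringKrullDim_add_length_eq_ringKrullDim_of_isRegular α
    (isRegular_iff_wreg'.2 ⟨hα, hαm⟩)
  rw [← hk, ringKrullDim_eq_of_ringEquiv (RingHom.quotientKerEquivOfSurjective hf)] at hdim
  have hle : α.length ≤ n := by
    have h0 : (0 : WithBot ℕ∞) ≤ ringKrullDim T := ringKrullDim_nonneg_of_nontrivial
    have := (add_le_add_left h0 (α.length : WithBot ℕ∞)).trans (hdim.le.trans hd)
    rw [zero_add] at this
    exact_mod_cast this
  refine ⟨hle, withBot_le_sub (hdim.le.trans hd), ?_⟩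
  obtain ⟨ρ, hρm, hρ, hρl⟩ := exists_wreg_append hm hαm hr hα (by omega)
  refine ⟨ρ.map f, by rw [List.length_map]; omega, fun y hy => ?_,
    (wreg_append_iff hf hα hk).1 hρ, ?_⟩
  · obtain ⟨x, hx, rfl⟩ := List.mem_map.1 hy
    rw [← maximalIdeal_map_of_surjective hf]
    exact Ideal.mem_map_of_mem f (hρm x hx)
  · have hs' : SimpleSocle (IsLocalRing.maximalIdeal A) (Ideal.ofList (α ++ ρ)) :=
      exchange le_rfl (SimpleSocle (IsLocalRing.maximalIdeal A))
        (fun zs a b _ ha hb hza hzb h => h.exchange ha hb hza hzb) n [] rs (α ++ ρ) hl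
        (by simp; omega) (by simp) hm
        (fun x hx => (List.mem_append.1 hx).elim (hαm x) (hρm x)) hr hρ hs
    rw [Ideal.ofList_append, sup_comm, ← hk] at hs'
    rw [ofList_map, ← maximalIdeal_map_of_surjective hf]
    exact hs'.map hf

end

lemma isLocalRing_quotient {A : Type} [CommRing A] [IsLocalRing A] {K : Ideal A} (hK : K ≠ ⊤) :
    IsLocalRing (A ⧸ K) := by
  have := Ideal.Quotient.nontrivial_iff.2 hK
  exact IsLocalRing.of_surjective' (Ideal.Quotient.mk K) Ideal.Quotient.mk_surjective

/-- Maximal Cohen-Macaulay cyclic modules over a Gorenstein ring are totally reflexive. -/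
lemma GorLike.gRefl (n : ℕ) : ∀ (A : Type) [CommRing A] [IsLocalRing A] [IsNoetherianRing A]
    (K : Ideal A), K ≠ ⊤ → GorLike A n →
    (∃ τ : List A, τ.length = n ∧ (∀ x ∈ τ, x ∈ IsLocalRing.maximalIdeal A) ∧
      IsWeaklyRegular (A ⧸ K) (τ.map (Ideal.Quotient.mk K))) → GRefl A K := by
  induction n with
  | zero =>
    intro A _ _ _ K _ h _
    obtain ⟨hd, rs, hl, _, _, hs⟩ := h
    obtain rfl := List.length_eq_zero_iff.1 hl
    have : Ring.KrullDimLE 0 A := Ring.krullDimLE_iff.2 (by exact_mod_cast hd)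
    have := isArtinianRing_iff_krullDimLE_zero.2 this
    exact gRefl_of_simpleSocle (by simpa using hs) K
  | succ n ih =>
    intro A _ _ _ K hK h hτ
    have hG := h
    obtain ⟨-, rs, hl, hm, hr, -⟩ := h
    obtain ⟨τ, hτl, hτm, hτr⟩ := hτ
    have hCloc := isLocalRing_quotient hK
    obtain ⟨r, rs, rfl⟩ := List.exists_cons_of_length_eq_add_one hl
    obtain ⟨t, τ, rfl⟩ := List.exists_cons_of_length_eq_add_one hτl
    have hr0 : NZD ⊥ r := by
      have := (isWeaklyRegular_append_iff A [r] rs).1 hr |>.1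
      rw [← List.nil_append [r], wreg_snoc] at this
      simpa using this.2
    have ht0 : NZD K t := by
      rw [List.map_cons] at hτr
      have := (isWeaklyRegular_append_iff (A ⧸ K) [Ideal.Quotient.mk K t] _).1 hτr |>.1
      rw [← List.nil_append [_], wreg_snoc, Ideal.ofList_nil, ← Ideal.map_bot (f := Ideal.Quotient.mk K),
        NZD_map_iff_of_ker Ideal.Quotient.mk_surjective] at this
      simpa using this.2
    obtain ⟨z, hz, hz1, hz2⟩ := exists_nzd_two (hm r (by simp)) (hτm t (by simp)) hr0 ht0
    let D := A ⧸ Ideal.span {z}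
    have hzt : Ideal.span {z} ≤ IsLocalRing.maximalIdeal A := by
      rwa [Ideal.span_singleton_le_iff_mem]
    have hDloc : IsLocalRing D := isLocalRing_quotient
      (ne_top_of_le_ne_top Ideal.IsPrime.ne_top' hzt)
    let f := Ideal.Quotient.mk (Ideal.span {z})
    have hf : Function.Surjective f := Ideal.Quotient.mk_surjective
    have hzr : IsWeaklyRegular A [z] := by
      rw [← List.nil_append [z], wreg_snoc]
      simpa using hz1
    have hGD : GorLike D n := (hG.of_surjective hf hzr (by simp [f])).2
    have hKD : K.map f ≠ ⊤ := ne_top_of_le_ne_top (Ideal.IsPrime.ne_top'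
      (I := IsLocalRing.maximalIdeal D)) ((Ideal.map_mono (IsLocalRing.le_maximalIdeal hK)).trans
        (maximalIdeal_map_of_surjective hf).le)
    let φ : A ⧸ K →+* D ⧸ K.map f := Ideal.quotientMap (K.map f) f Ideal.le_comap_map
    have hφ : Function.Surjective φ := Ideal.quotientMap_surjective hf
    have hφk : RingHom.ker φ = Ideal.ofList [Ideal.Quotient.mk K z] := by
      ext y
      obtain ⟨y, rfl⟩ := Ideal.Quotient.mk_surjective y
      have h1 : φ (Ideal.Quotient.mk K y) = 0 ↔ y ∈ K ⊔ Ideal.span {z} := by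
        rw [Ideal.quotientMap_mk, Ideal.Quotient.eq_zero_iff_mem, mem_map_iff_of_ker hf,
          Ideal.mk_ker]
      rw [RingHom.mem_ker, h1, Ideal.ofList_singleton, ← Set.image_singleton, ← Ideal.map_span,
        mem_map_iff_of_ker Ideal.Quotient.mk_surjective, Ideal.mk_ker, sup_comm]
    have hzC : IsWeaklyRegular (A ⧸ K) [Ideal.Quotient.mk K z] := by
      rw [← List.nil_append [_], wreg_snoc, Ideal.ofList_nil,
        ← Ideal.map_bot (f := Ideal.Quotient.mk K), NZD_map_iff_of_ker Ideal.Quotient.mk_surjective]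
      simpa using hz2
    have hmC : ∀ x ∈ IsLocalRing.maximalIdeal A,
        Ideal.Quotient.mk K x ∈ IsLocalRing.maximalIdeal (A ⧸ K) := fun x hx => by
      rw [← maximalIdeal_map_of_surjective Ideal.Quotient.mk_surjective]
      exact Ideal.mem_map_of_mem _ hx
    obtain ⟨ρ, hρm, hρ, hρl⟩ := exists_wreg_append (B := A ⧸ K)
      (τ := (t :: τ).map (Ideal.Quotient.mk K)) (β := [Ideal.Quotient.mk K z])
      (fun y hy => by
        obtain ⟨x, hx, rfl⟩ := List.mem_map.1 hy
        exact hmC x (hτm x hx)) (by simpa using hmC z hz) hτr hzC (by simp)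
    have hρ' := (wreg_append_iff hφ hzC hφk).1 hρ
    obtain ⟨ρ, rfl⟩ := List.map_surjective_iff.2 (Ideal.Quotient.mk_surjective (I := K)) ρ
    have hres := ih D (K.map f) hKD hGD ⟨ρ.map f, by simp at hρl hτl ⊢; omega, fun y hy => by
      obtain ⟨x, hx, rfl⟩ := List.mem_map.1 hy
      have hx' := hρm _ (List.mem_map_of_mem hx)
      rw [← maximalIdeal_map_of_surjective hf]
      exact Ideal.mem_map_of_mem f fun hu => hx' (hu.map _), by
      rw [List.map_map] at hρ' ⊢
      exact hρ'⟩
    exact GRefl.deform (D := D) hf hz hz1 (fun a => by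
      rw [← Ideal.mem_span_singleton]; exact Ideal.Quotient.eq_zero_iff_mem) hz2 hres

section

/-- The depth of a local ring is at most the dimension of the quotient by any associated prime. -/
lemma length_le_ringKrullDim_quotient (n : ℕ) : ∀ (B : Type) [CommRing B] [IsLocalRing B]
    [IsNoetherianRing B] (τ : List B) (p : Ideal B) [p.IsPrime] (v : B), τ.length = n →
    (∀ x ∈ τ, x ∈ IsLocalRing.maximalIdeal B) → IsWeaklyRegular B τ → (∀ s, s ∈ p ↔ s * v = 0) →
    (n : WithBot ℕ∞) ≤ ringKrullDim (B ⧸ p) := by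
  induction n with
  | zero =>
    intro B _ _ _ τ p _ v _ _ _ _
    exact_mod_cast ringKrullDim_nonneg_of_nontrivial
  | succ n ih =>
    intro B _ _ _ τ p _ v hl hm hr hv
    obtain ⟨x, τ, rfl⟩ := List.exists_cons_of_length_eq_add_one hl
    have hxr : IsWeaklyRegular B [x] := ((isWeaklyRegular_append_iff B [x] τ).1 hr).1
    have hx : NZD ⊥ x := by
      rw [← List.nil_append [x], wreg_snoc, Ideal.ofList_nil] at hxr
      exact hxr.2
    have hv0 : v ≠ 0 := by
      rintro rfl
      exact Ideal.IsPrime.ne_top' (I := p) ((Ideal.eq_top_iff_one p).2 ((hv 1).2 (mul_zero 1)))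
    have hxp : x ∉ p := fun h => hv0 (hx v ((hv x).1 h))
    have hxm : x ∈ IsLocalRing.maximalIdeal B := hm x (by simp)
    obtain ⟨w, hwp, hwx⟩ : ∃ w ∈ (⊥ : Ideal B).colon (p : Set B), w ∉ Ideal.span {x} := by
      by_contra! hcon
      let N : Ideal B := (⊥ : Ideal B).colon (p : Set B)
      have hN : N ≤ IsLocalRing.maximalIdeal B • N := fun w hw => by
        obtain ⟨y, rfl⟩ := Ideal.mem_span_singleton.1 (hcon w hw)
        refine Submodule.smul_mem_smul hxm (mem_colon_ideal.2 fun s hs => hx _ ?_)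
        rw [← mul_assoc]
        exact mem_colon_ideal.1 hw s hs
      have := Submodule.eq_bot_of_le_smul_of_le_jacobson_bot _ N (IsNoetherian.noetherian N) hN
        (IsLocalRing.jacobson_eq_maximalIdeal ⊥ bot_ne_top).ge
      have hvN : v ∈ N := mem_colon_ideal.2 fun s hs => by
        rw [mul_comm]
        exact (hv s).1 hs
      rw [this] at hvN
      exact hv0 hvN
    let D := B ⧸ Ideal.span {x}
    have hxt : Ideal.span {x} ≠ (⊤ : Ideal B) := ne_top_of_le_ne_top Ideal.IsPrime.ne_top'
      ((Ideal.span_singleton_le_iff_mem _).2 hxm)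
    have hDloc : IsLocalRing D := isLocalRing_quotient hxt
    let f : B →+* D := Ideal.Quotient.mk (Ideal.span {x})
    have hf : Function.Surjective f := Ideal.Quotient.mk_surjective
    have hτ := (wreg_append_iff hf (α := [x]) (β := τ) hxr
      (by rw [Ideal.ofList_singleton]; exact Ideal.mk_ker)).1 hr
    have hτm : ∀ y ∈ τ.map f, y ∈ IsLocalRing.maximalIdeal D := fun y hy => by
      obtain ⟨y, hy', rfl⟩ := List.mem_map.1 hy
      rw [← maximalIdeal_map_of_surjective hf]
      exact Ideal.mem_map_of_mem f (hm y (List.mem_cons_of_mem _ hy'))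
    obtain ⟨q, hq, hqw⟩ := exists_le_isAssociatedPrime_of_isNoetherianRing D (f w)
      (fun h => hwx (Ideal.Quotient.eq_zero_iff_mem.1 h))
    obtain ⟨hqp, u, hu⟩ := isAssociatedPrime_iff.1 hq
    have h1 := ih D (τ.map f) q u (by simpa using hl) hτm hτ fun s => by
      rw [hu, Submodule.mem_colon_singleton, Submodule.mem_bot, smul_eq_mul]
    have hpq : ∀ s ∈ p, f s ∈ q := fun s hs => hqw (by
      rw [Submodule.mem_colon_singleton, Submodule.mem_bot, smul_eq_mul, ← map_mul, mul_comm,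
        (Ideal.mem_bot.1 (mem_colon_ideal.1 hwp s hs) : w * s = 0), map_zero])
    let g : B ⧸ p →+* D ⧸ q := Ideal.quotientMap q f hpq
    have hg : Function.Surjective g := Ideal.quotientMap_surjective hf
    let g' : (B ⧸ p) ⧸ Ideal.span {Ideal.Quotient.mk p x} →+* D ⧸ q :=
      Ideal.Quotient.lift _ g fun a ha => by
        obtain ⟨b, rfl⟩ := Ideal.mem_span_singleton.1 ha
        have : f x = 0 := Ideal.Quotient.eq_zero_iff_mem.2 (Ideal.mem_span_singleton_self x)
        have hgx : g (Ideal.Quotient.mk p x) = 0 := by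
          change Ideal.Quotient.mk q (f x) = 0
          rw [this, map_zero]
        rw [map_mul, hgx, zero_mul]
    have hg' : Function.Surjective g' := Ideal.Quotient.lift_surjective_of_surjective _ _ hg
    have h2 := ringKrullDim_quotient_succ_le_of_nonZeroDivisor (R := B ⧸ p)
      (r := Ideal.Quotient.mk p x) (mem_nonZeroDivisors_of_ne_zero fun h =>
        hxp (Ideal.Quotient.eq_zero_iff_mem.1 h))
    rw [Nat.cast_add, Nat.cast_one]
    exact (add_le_add_left (h1.trans (ringKrullDim_le_of_surjective g' hg')) 1).trans h2

variable {R : Type} [CommRing R] [IsLocalRing R] [IsNoetherianRing R]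

lemma simpleSocle_of_infIrred {q : Ideal R} (hq : InfIrred q)
    (hrad : q.radical = IsLocalRing.maximalIdeal R) :
    SimpleSocle (IsLocalRing.maximalIdeal R) q := by
  have hq1 : q ≠ ⊤ := fun h => hq.1 (by rw [h]; exact isMax_top)
  obtain ⟨p, hp, -⟩ := exists_le_isAssociatedPrime_of_isNoetherianRing R (M := R ⧸ q)
    (Ideal.Quotient.mk q 1) (fun h => hq1 ((Ideal.eq_top_iff_one q).2
      (Ideal.Quotient.eq_zero_iff_mem.1 h)))
  obtain ⟨hpp, u, hu⟩ := isAssociatedPrime_iff.1 hp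
  obtain ⟨u, rfl⟩ := Ideal.Quotient.mk_surjective u
  have hup : ∀ s, s ∈ p ↔ u * s ∈ q := fun s => by
    rw [hu, Submodule.mem_colon_singleton, Submodule.mem_bot, mul_comm,
      ← Ideal.Quotient.eq_zero_iff_mem]
    rfl
  have hu1 : u ∉ q := fun h => hpp.ne_top ((Ideal.eq_top_iff_one p).2 ((hup 1).2 (by simpa)))
  have hm : ∀ v ∈ IsLocalRing.maximalIdeal R, u * v ∈ q := fun v hv => (hup v).1 <|
    hpp.radical_le_iff.2 (fun x hx => (hup x).2 (q.mul_mem_left u hx)) (hrad.ge hv)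
  refine ⟨u, hu1, hm, fun w hw => ?_⟩
  by_cases hwq : w ∈ q
  · exact ⟨0, by simpa⟩
  have hne : ¬ (q ⊔ Ideal.span {u}) ⊓ (q ⊔ Ideal.span {w}) ≤ q := fun hle => by
    rcases hq.2 (le_antisymm hle (le_inf le_sup_left le_sup_left)) with h | h
    · exact hu1 (h.le (Ideal.mem_sup_right (Ideal.mem_span_singleton_self u)))
    · exact hwq (h.le (Ideal.mem_sup_right (Ideal.mem_span_singleton_self w)))
  obtain ⟨y, ⟨hy1, hy2⟩, hyq⟩ := SetLike.not_le_iff_exists.1 hne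
  obtain ⟨a, ha⟩ := mem_sup_span_singleton.1 hy1
  obtain ⟨b, hb⟩ := mem_sup_span_singleton.1 hy2
  have hbu : IsUnit b := by
    by_contra hbu
    exact hyq (by simpa using add_mem hb (hw b hbu))
  obtain ⟨c, hc⟩ := hbu.exists_right_inv
  refine ⟨a * c, ?_⟩
  have := q.mul_mem_left c (sub_mem ha hb)
  convert this using 1
  linear_combination w * hc.symm

lemma GorLike.of_isGorensteinLocalRing (h : IsGorensteinLocalRing R) : ∃ n, GorLike R n := by
  obtain ⟨-, rs, hr, hrad, hirr⟩ := h
  obtain ⟨hw, hm⟩ := isRegular_iff_wreg'.1 hr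
  refine ⟨rs.length, ?_, rs, rfl, hm, hw, simpleSocle_of_infIrred hirr hrad⟩
  have hloc := isLocalRing_quotient (isRegular_iff_wreg.1 hr).2
  have : Ring.KrullDimLE 0 (R ⧸ Ideal.ofList rs) := Ring.KrullDimLE.mk₀ fun P hP => by
    have h1 : IsLocalRing.maximalIdeal R ≤ P.comap (Ideal.Quotient.mk (Ideal.ofList rs)) := by
      rw [← hrad, (hP.comap _).radical_le_iff]
      intro x hx
      rw [Ideal.mem_comap, Ideal.Quotient.eq_zero_iff_mem.2 hx]
      exact zero_mem P
    have h2 : IsLocalRing.maximalIdeal (R ⧸ Ideal.ofList rs) ≤ P := by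
      rw [← maximalIdeal_map_of_surjective Ideal.Quotient.mk_surjective]
      exact Ideal.map_le_iff_le_comap.2 h1
    exact (IsLocalRing.maximalIdeal.isMaximal _).eq_of_le hP.ne_top h2 ▸
      IsLocalRing.maximalIdeal.isMaximal _
  rw [← ringKrullDim_add_length_eq_ringKrullDim_of_isRegular rs hr]
  have h0 : ringKrullDim (R ⧸ Ideal.ofList rs) ≤ 0 := by
    exact_mod_cast Ring.krullDimLE_iff.1 this
  simpa using add_le_add_left h0 (rs.length : WithBot ℕ∞)

/-- Links of Cohen-Macaulay ideals in Gorenstein rings are totally reflexive modulo the link. -/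
lemma exists_isRegular_gPerf {I : Ideal R} (hG : IsGorensteinLocalRing R) (hI : IsCMIdeal R I) :
    ∃ α : List R, (∀ x ∈ α, x ∈ I) ∧ IsRegular R α ∧ GPerf α.length I := by
  classical
  obtain ⟨D, hD⟩ := GorLike.of_isGorensteinLocalRing hG
  obtain ⟨hloc, hCM⟩ := hI
  have hdim : ringKrullDim (R ⧸ I) =
      (gradeOf (R ⧸ I) (IsLocalRing.maximalIdeal (R ⧸ I)) : WithBot ℕ∞) := hCM
  have hI1 : I ≠ ⊤ := Ideal.Quotient.nontrivial_iff.1 inferInstance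
  have hIm := IsLocalRing.le_maximalIdeal hI1
  have hquot : ∀ α : List R, (∀ x ∈ α, x ∈ I) → IsLocalRing (R ⧸ Ideal.ofList α) := fun α hα =>
    isLocalRing_quotient (ne_top_of_le_ne_top hI1 (ofList_le.2 hα))
  have hbd : ∀ α : List R, (hα : ∀ x ∈ α, x ∈ I) → IsWeaklyRegular R α →
      α.length ≤ D ∧ @GorLike (R ⧸ Ideal.ofList α) _ (hquot α hα) (D - α.length) :=
    fun α hα hr => by
      have := hquot α hα
      exact hD.of_surjective Ideal.Quotient.mk_surjective hr Ideal.mk_ker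
  obtain ⟨α, hα, hr, hmax⟩ : ∃ α : List R, (∀ x ∈ α, x ∈ I) ∧ IsWeaklyRegular R α ∧
      ∀ z ∈ I, ¬ NZD (Ideal.ofList α) z := by
    let P : ℕ → Prop := fun n => ∃ α : List R, α.length = n ∧ (∀ x ∈ α, x ∈ I) ∧
      IsWeaklyRegular R α
    have hP0 : P 0 := ⟨[], rfl, by simp, IsWeaklyRegular.nil R R⟩
    obtain ⟨α, hl, hα, hr⟩ := Nat.findGreatest_spec (P := P) (Nat.zero_le D) hP0
    refine ⟨α, hα, hr, fun z hz hzα => ?_⟩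
    have hr' := wreg_snoc.2 ⟨hr, hzα⟩
    have hα' : ∀ x ∈ α ++ [z], x ∈ I := by simpa [or_imp, forall_and] using ⟨hα, hz⟩
    have := Nat.le_findGreatest (P := P) (hbd _ hα' hr').1 ⟨α ++ [z], rfl, hα', hr'⟩
    rw [List.length_append, List.length_singleton] at this
    omega
  have hrr : IsRegular R α := isRegular_iff_wreg'.2 ⟨hr, fun x hx => hIm (hα x hx)⟩
  refine ⟨α, hα, hrr, (GPerf_iff_of_isRegular rfl hα hrr).2 ?_⟩
  have hAloc := hquot α hα
  have hAG := (hbd α hα hr).2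
  let A := R ⧸ Ideal.ofList α
  let f : R →+* A := Ideal.Quotient.mk (Ideal.ofList α)
  have hf : Function.Surjective f := Ideal.Quotient.mk_surjective
  have hαI : Ideal.ofList α ≤ I := ofList_le.2 hα
  have hfI : (I.map f).comap f = I := by
    rw [Ideal.comap_map_of_surjective _ hf, ← RingHom.ker_eq_comap_bot, Ideal.mk_ker,
      sup_eq_left.2 hαI]
  have hIf : I.map f ≠ ⊤ := fun h => hI1 (by rw [← hfI, h, Ideal.comap_top])
  refine GorLike.gRefl (D - α.length) A (I.map f) hIf hAG ?_
  let φ : R ⧸ I →+* A ⧸ I.map f := Ideal.quotientMap (I.map f) f Ideal.le_comap_map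
  have hφ : Function.Surjective φ := Ideal.quotientMap_surjective hf
  have hφk : RingHom.ker φ = Ideal.ofList [] := by
    rw [Ideal.ofList_nil, ← RingHom.injective_iff_ker_eq_bot]
    exact Ideal.quotientMap_injective' hfI.le
  obtain ⟨p, hp, hIp⟩ : ∃ p ∈ associatedPrimes A (A ⧸ (⊥ : Ideal A)), I.map f ≤ p := by
    by_contra! hcon
    obtain ⟨z, hz, hz'⟩ := exists_mem_avoid (associatedPrimes.finite A (A ⧸ (⊥ : Ideal A)))
      (fun p hp => hp.isPrime) hcon
    have hz'' := nzd_iff_associatedPrimes.2 hz'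
    obtain ⟨z, hzI, rfl⟩ := (Ideal.mem_map_iff_of_surjective f hf).1 hz
    refine hmax z hzI ?_
    rw [← Ideal.map_bot (f := f), NZD_map_iff_of_ker hf, Ideal.mk_ker, bot_sup_eq] at hz''
    exact hz''
  obtain ⟨hpp, v, hv⟩ := isAssociatedPrime_iff.1 hp
  obtain ⟨v, rfl⟩ := Ideal.Quotient.mk_surjective v
  obtain ⟨rs, hrl, hrm, hrr', -⟩ := hAG.2
  have h1 := length_le_ringKrullDim_quotient (D - α.length) A rs p v hrl hrm hrr' fun s => by
    rw [hv, Submodule.mem_colon_singleton, Submodule.mem_bot, ← Ideal.mem_bot (x := s * v),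
      ← Ideal.Quotient.eq_zero_iff_mem]
    rfl
  have h2 : ringKrullDim (A ⧸ p) ≤ ringKrullDim (R ⧸ I) := ringKrullDim_le_of_surjective
    ((Ideal.Quotient.factor hIp).comp φ) ((Ideal.Quotient.factor_surjective hIp).comp hφ)
  have h3 := h1.trans (h2.trans hdim.le)
  have hbdd : ∀ n ∈ {n : ℕ | ∃ rs : List (R ⧸ I), rs.length = n ∧
      (∀ r ∈ rs, r ∈ IsLocalRing.maximalIdeal (R ⧸ I)) ∧ IsRegular (R ⧸ I) rs},
      n ≤ gradeOf (R ⧸ I) (IsLocalRing.maximalIdeal (R ⧸ I)) := by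
    rintro _ ⟨rs, rfl, -, hrs⟩
    have h4 := ringKrullDim_add_length_eq_ringKrullDim_of_isRegular rs hrs
    have : Nontrivial ((R ⧸ I) ⧸ Ideal.ofList rs) :=
      Ideal.Quotient.nontrivial_iff.2 (isRegular_iff_wreg.1 hrs).2
    have h0 : (0 : WithBot ℕ∞) ≤ ringKrullDim ((R ⧸ I) ⧸ Ideal.ofList rs) :=
      ringKrullDim_nonneg_of_nontrivial
    have h5 := (add_le_add_left h0 (rs.length : WithBot ℕ∞)).trans (h4.le.trans hdim.le)
    rw [zero_add] at h5
    exact_mod_cast h5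
  obtain ⟨σ, hσl, hσm, hσ⟩ := Nat.sSup_mem (s := {n : ℕ | ∃ rs : List (R ⧸ I), rs.length = n ∧
      (∀ r ∈ rs, r ∈ IsLocalRing.maximalIdeal (R ⧸ I)) ∧ IsRegular (R ⧸ I) rs})
    ⟨0, [], rfl, by simp, isRegular_iff_wreg'.2 ⟨IsWeaklyRegular.nil _ _, by simp⟩⟩ ⟨_, hbdd⟩
  have h6 : D - α.length ≤ σ.length := by
    rw [hσl]
    change _ ≤ gradeOf (R ⧸ I) _
    exact_mod_cast h3
  obtain ⟨σ, rfl⟩ := List.map_surjective_iff.2 (Ideal.Quotient.mk_surjective (I := I)) σ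
  rw [List.length_map] at h6
  refine ⟨(σ.take (D - α.length)).map f, by simpa using h6, fun y hy => ?_, ?_⟩
  · obtain ⟨x, hx, rfl⟩ := List.mem_map.1 hy
    have hx' := hσm _ (List.mem_map_of_mem (List.mem_of_mem_take hx))
    rw [← maximalIdeal_map_of_surjective hf]
    exact Ideal.mem_map_of_mem f fun hu => hx' (hu.map _)
  · have hw := (isRegular_iff_wreg.1 hσ).1
    rw [← List.take_append_drop (D - α.length) σ, List.map_append, isWeaklyRegular_append_iff] at hw
    have h7 := (wreg_append_iff hφ (IsWeaklyRegular.nil _ _) hφk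
      (β := (σ.take (D - α.length)).map (Ideal.Quotient.mk I))).1 (by simpa using hw.1)
    rw [List.map_map] at h7 ⊢
    exact h7

end

end

/-- Theorem 2.6(d). Let `I` be a Cohen-Macaulay ideal of positive grade
in a Noetherian local Gorenstein ring `R` with infinite residue field, and let `T` be a
flat local Gorenstein extension of `R` with `IT ≠ T`.  Then `∫_T(IT) = (∫_R I)T`.
In particular, for every prime `p ⊇ I`, `∫_{R_p}(I_p) = (∫_R I)_p`. -/
theorem statement5 (R : Type) [CommRing R] [IsLocalRing R] [IsNoetherianRing R]
    (hGor : IsGorensteinLocalRing R) (hres : Infinite (IsLocalRing.ResidueField R))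
    (I : Ideal R) (hCM : IsCMIdeal R I) (hgrade : ∃ r ∈ I, r ∈ nonZeroDivisors R)
    (T : Type) [CommRing T] [IsLocalRing T] [IsNoetherianRing T]
    [Algebra R T] [Module.Flat R T] (hGorT : IsGorensteinLocalRing T)
    (hIT : I.map (algebraMap R T) ≠ ⊤) :
    intLink T (I.map (algebraMap R T)) = (intLink R I).map (algebraMap R T) ∧
    ∀ (p : Ideal R) (hp : p.IsPrime), I ≤ p →
      (letI := hp
       intLink (Localization.AtPrime p) (I.map (algebraMap R (Localization.AtPrime p))) =
         (intLink R I).map (algebraMap R (Localization.AtPrime p))) := by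
  have := hres
  obtain ⟨α, hα, hr, hP⟩ := exists_isRegular_gPerf hGor hCM
  refine ⟨intLink_map_of_flat hP rfl hα hr hIT, fun p hp hIp => ?_⟩
  have : IsNoetherianRing (Localization.AtPrime p) :=
    IsLocalization.isNoetherianRing p.primeCompl _ inferInstance
  have : Module.Flat R (Localization.AtPrime p) := IsLocalization.flat _ p.primeCompl
  refine intLink_map_of_flat hP rfl hα hr (ne_top_of_le_ne_top
    (IsLocalRing.maximalIdeal.isMaximal (Localization.AtPrime p)).ne_top ?_)
  rw [← Localization.AtPrime.map_eq_maximalIdeal]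
  exact Ideal.map_mono hIp
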